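/- Let T and T′ be increasing tableaux of type A. Then the row words of T and T′ are K-Knuth equivalent if and only if T and T′ are jeu de taquin equivalent for the poset ℕ×ℕ. -/

import Mathlib

open Classical

noncomputable section

/-- A straight shape in a poset: a finite lower order ideal, given as a `Finset`. -/
def StraightShape {L : Type} [PartialOrder L] (lam : Finset L) : Prop :=
  ∀ a ∈ lam, ∀ b : L, b ≤ a → b ∈ lam

/-- The shape (set of boxes) of a partially defined tableau. -/
def shapeOf {L : Type} {V : Type} (T : L → Option V) : Set L := {α | T α ≠ none}

/-- `lam ⊆ nu` is a pair of straight shapes, defining the skew shape `nu / lam`. -/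
def IsSkewPair {L : Type} [PartialOrder L] (lam nu : Finset L) : Prop :=
  StraightShape lam ∧ StraightShape nu ∧ lam ⊆ nu

/-- `T` is defined on a skew shape `nu / lam`. -/
def HasSkewShape {L : Type} [PartialOrder L] (T : L → Option ℤ) : Prop :=
  ∃ lam nu : Finset L, IsSkewPair lam nu ∧ shapeOf T = (nu : Set L) \ (lam : Set L)

/-- `T` is strictly increasing along the partial order. -/
def Increasing {L : Type} [PartialOrder L] (T : L → Option ℤ) : Prop :=
  ∀ a b : L, a < b → ∀ x y : ℤ, T a = some x → T b = some y → x < y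

/-- An increasing tableau of skew shape. -/
def IncreasingSkewTableau {L : Type} [PartialOrder L] (T : L → Option ℤ) : Prop :=
  HasSkewShape T ∧ Increasing T

/-- Two boxes are neighbors if one covers the other. -/
def Neighbor {L : Type} [PartialOrder L] (a b : L) : Prop := a ⋖ b ∨ b ⋖ a

/-- The swap operation `swap_{s,s'}`. -/
def swapVal {L : Type} [PartialOrder L] {V : Type} (s s' : V) (T : L → Option V) :
    L → Option V := fun α =>
  if T α = some s ∧ ∃ β, Neighbor α β ∧ T β = some s' then some s'
  else if T α = some s' ∧ ∃ β, Neighbor α β ∧ T β = some s then some s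
  else T α

/-- Integer values extended with a dot `•`. -/
abbrev ZDot : Type := ℤ ⊕ Unit

def toDotted {L : Type} (T : L → Option ℤ) : L → Option ZDot := fun α => (T α).map Sum.inl

/-- Place a dot in every box of `C`. -/
def addDots {L : Type} (C : Finset L) (T : L → Option ZDot) : L → Option ZDot := fun α =>
  if α ∈ C then some (Sum.inr ()) else T α

/-- Restrict a dotted tableau to its integer-valued boxes. -/
def restrictInt {L : Type} (T : L → Option ZDot) : L → Option ℤ := fun α =>
  (T α).bind (Sum.elim some fun _ => none)

/-- Apply `swap_{a,•}, swap_{a+1,•}, …, swap_{a+n-1,•}` in this (increasing) order. -/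
def swapUp {L : Type} [PartialOrder L] (a : ℤ) : ℕ → (L → Option ZDot) → (L → Option ZDot)
  | 0, T => T
  | n + 1, T => swapVal (Sum.inl (a + n)) (Sum.inr ()) (swapUp a n T)

/-- Apply `swap_{b,•}, swap_{b-1,•}, …, swap_{b-n+1,•}` in this (decreasing) order. -/
def swapDown {L : Type} [PartialOrder L] (b : ℤ) : ℕ → (L → Option ZDot) → (L → Option ZDot)
  | 0, T => T
  | n + 1, T => swapVal (Sum.inl (b - n)) (Sum.inr ()) (swapDown b n T)

/-- All values of `T` lie in the interval `[a, b]`. -/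
def ValuesIn {L : Type} (T : L → Option ℤ) (a b : ℤ) : Prop :=
  ∀ (α : L) (x : ℤ), T α = some x → a ≤ x ∧ x ≤ b

/-- `T'` is obtained from `T` by a single forward jeu de taquin slide `jdt_C`,
starting from a set `C` of maximal boxes of the inner shape. -/
def IsForwardSlide {L : Type} [PartialOrder L] (T T' : L → Option ℤ) : Prop :=
  ∃ (lam nu C : Finset L) (a b : ℤ),
    IsSkewPair lam nu ∧ shapeOf T = (nu : Set L) \ (lam : Set L) ∧ ValuesIn T a b ∧
    (∀ c ∈ C, c ∈ lam ∧ ∀ d ∈ lam, ¬ c < d) ∧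
    T' = restrictInt (swapUp a (b - a + 1).toNat (addDots C (toDotted T)))

/-- `T'` is obtained from `T` by a single reverse jeu de taquin slide,
starting from a set `C` of minimal boxes of the complement of the outer shape. -/
def IsReverseSlide {L : Type} [PartialOrder L] (T T' : L → Option ℤ) : Prop :=
  ∃ (lam nu C : Finset L) (a b : ℤ),
    IsSkewPair lam nu ∧ shapeOf T = (nu : Set L) \ (lam : Set L) ∧ ValuesIn T a b ∧
    (∀ c ∈ C, c ∉ nu ∧ ∀ d : L, d ∉ nu → ¬ d < c) ∧
    T' = restrictInt (swapDown b (b - a + 1).toNat (addDots C (toDotted T)))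

/-- Jeu de taquin equivalence: a finite sequence of forward and reverse slides. -/
def JdtEquiv {L : Type} [PartialOrder L] (T T' : L → Option ℤ) : Prop :=
  Relation.ReflTransGen (fun A B => IsForwardSlide A B ∨ IsReverseSlide A B) T T'

/-- `T` is defined on a straight shape. -/
def HasStraightShape {L : Type} [PartialOrder L] (T : L → Option ℤ) : Prop :=
  ∃ lam : Finset L, StraightShape lam ∧ shapeOf T = (lam : Set L)

/-- `U` is a rectification of `T`: a straight-shape tableau obtained by forward slides. -/
def RectifiesTo {L : Type} [PartialOrder L] (T U : L → Option ℤ) : Prop :=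
  Relation.ReflTransGen IsForwardSlide T U ∧ HasStraightShape U

/-- Unique rectification target. -/
def IsURT {L : Type} [PartialOrder L] (U : L → Option ℤ) : Prop :=
  HasStraightShape U ∧ Increasing U ∧
    ∀ T : L → Option ℤ, IncreasingSkewTableau T → RectifiesTo T U →
      ∀ U' : L → Option ℤ, RectifiesTo T U' → U' = U

/-- The minimal increasing tableau of a shape `θ`: each box `α` receives the maximal
cardinality of a totally ordered subset of `θ` having `α` as its maximal element. -/
def minTab {L : Type} [PartialOrder L] (θ : Finset L) : L → Option ℤ := fun α =>
  if α ∈ θ then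
    some ((sSup {n : ℕ | ∃ s : Finset L, (s : Set L) ⊆ (θ : Set L) ∧
      (∀ a ∈ s, ∀ b ∈ s, a ≤ b ∨ b ≤ a) ∧ α ∈ s ∧ (∀ a ∈ s, a ≤ α) ∧ s.card = n} : ℕ) : ℤ)
  else none

/-- A unique rectification poset. -/
def IsURP (L : Type) [PartialOrder L] : Prop :=
  ∀ lam : Finset L, StraightShape lam → IsURT (minTab lam)

/-- The structure constant `c^ν_{λ,μ}`: the number of increasing tableaux of
shape `ν/λ` that have the minimal increasing tableau `M_μ` as a rectification. -/
def ccoef {L : Type} [PartialOrder L] (lam mu nu : Finset L) : ℕ :=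
  Set.ncard {T : L → Option ℤ | Increasing T ∧ shapeOf T = (nu : Set L) \ (lam : Set L) ∧
    RectifiesTo T (minTab mu)}

/-- The basic K-Knuth relations. -/
inductive KKnuthStep : List ℤ → List ℤ → Prop
  | dup (u v : List ℤ) (a : ℤ) : KKnuthStep (u ++ [a, a] ++ v) (u ++ [a] ++ v)
  | aba (u v : List ℤ) (a b : ℤ) : KKnuthStep (u ++ [a, b, a] ++ v) (u ++ [b, a, b] ++ v)
  | acb (u v : List ℤ) (a b c : ℤ) (h1 : b < a) (h2 : a < c) :
      KKnuthStep (u ++ [a, b, c] ++ v) (u ++ [a, c, b] ++ v)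
  | bac (u v : List ℤ) (a b c : ℤ) (h1 : a < c) (h2 : c < b) :
      KKnuthStep (u ++ [a, b, c] ++ v) (u ++ [b, a, c] ++ v)

/-- K-Knuth equivalence: the symmetric transitive closure of the basic relations. -/
def KKnuth : List ℤ → List ℤ → Prop := Relation.EqvGen KKnuthStep

/-- The row word of a tableau on boxes in `ℕ × ℕ`: entries are read row by row
from left to right, starting with the bottom row; `rmax` and `cmax` are bounds
enclosing the shape. -/
def rowWord (T : ℕ × ℕ → Option ℤ) (rmax cmax : ℕ) : List ℤ :=
  (List.range (rmax + 1)).reverse.flatMap fun r =>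
    (List.range (cmax + 1)).filterMap fun c => T (r, c)

/-- The shape of `T` is contained in the rectangle `[0, rmax] × [0, cmax]`. -/
def BoundedBy (T : ℕ × ℕ → Option ℤ) (rmax cmax : ℕ) : Prop :=
  ∀ p : ℕ × ℕ, T p ≠ none → p.1 ≤ rmax ∧ p.2 ≤ cmax

/-- The position of an entry in the linear order on `ℤ ∪ {•}` in which the dot is placed
between `s - 1` and `s`. -/
def dotLevel (s : ℤ) : ZDot → ℤ := Sum.elim (fun x => 2 * x) fun _ => 2 * s - 1

@[simp] lemma dotLevel_inl (s x : ℤ) : dotLevel s (Sum.inl x) = 2 * x := rfl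

@[simp] lemma dotLevel_inr (s : ℤ) (u : Unit) : dotLevel s (Sum.inr u) = 2 * s - 1 := rfl

/-- A dotted tableau of shape `S` which is increasing when dots are placed between
`s - 1` and `s`. -/
structure IncreasingAt (S : Set (ℕ × ℕ)) (s : ℤ) (D : ℕ × ℕ → Option ZDot) : Prop where
  shape : ∀ α, α ∈ S ↔ D α ≠ none
  lt : ∀ α β, α < β → ∀ u v, D α = some u → D β = some v → dotLevel s u < dotLevel s v

/-- The swap `swap_{s,•}`. -/
abbrev swapDot (s : ℤ) (D : ℕ × ℕ → Option ZDot) : ℕ × ℕ → Option ZDot :=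
  swapVal (Sum.inl s) (Sum.inr ()) D

lemma swapDot_eq_inl_iff_of_ne {s x : ℤ} (h : x ≠ s) (D : ℕ × ℕ → Option ZDot) (α : ℕ × ℕ) :
    swapDot s D α = some (Sum.inl x) ↔ D α = some (Sum.inl x) := by
  unfold swapDot swapVal
  split_ifs with h1 h2 <;> simp_all <;> omega

lemma swapDot_eq_none_iff (s : ℤ) (D : ℕ × ℕ → Option ZDot) (α : ℕ × ℕ) :
    swapDot s D α = none ↔ D α = none := by
  unfold swapDot swapVal
  split_ifs with h1 h2 <;> simp_all

lemma swapDot_eq_inl_iff (s : ℤ) (D : ℕ × ℕ → Option ZDot) (α : ℕ × ℕ) :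
    swapDot s D α = some (Sum.inl s) ↔
      (D α = some (Sum.inl s) ∧ ∀ β, Neighbor α β → D β ≠ some (Sum.inr ())) ∨
      (D α = some (Sum.inr ()) ∧ ∃ β, Neighbor α β ∧ D β = some (Sum.inl s)) := by
  unfold swapDot swapVal
  split_ifs with h1 h2
  · obtain ⟨h, β, hβ, hD⟩ := h1
    simp only [h]
    simp only [reduceCtorEq, Option.some.injEq, true_and, false_and, or_false, false_iff,
      not_forall]
    exact ⟨β, hβ, fun h => h hD⟩
  · simp [h2.1, h2.2]
  · constructor
    · intro h
      exact Or.inl ⟨h, fun β hβ hD => h1 ⟨h, β, hβ, hD⟩⟩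
    · rintro (h | h)
      · exact h.1
      · exact absurd h h2

lemma swapDot_eq_inr_iff (s : ℤ) (D : ℕ × ℕ → Option ZDot) (α : ℕ × ℕ) :
    swapDot s D α = some (Sum.inr ()) ↔
      (D α = some (Sum.inr ()) ∧ ∀ β, Neighbor α β → D β ≠ some (Sum.inl s)) ∨
      (D α = some (Sum.inl s) ∧ ∃ β, Neighbor α β ∧ D β = some (Sum.inr ())) := by
  unfold swapDot swapVal
  split_ifs with h1 h2
  · simp [h1.1, h1.2]
  · obtain ⟨h, β, hβ, hD⟩ := h2
    simp only [h]
    simp only [reduceCtorEq, Option.some.injEq, true_and, false_and, or_false, false_iff,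
      not_forall]
    exact ⟨β, hβ, fun h => h hD⟩
  · constructor
    · intro h
      exact Or.inl ⟨h, fun β hβ hD => h2 ⟨h, β, hβ, hD⟩⟩
    · rintro (h | h)
      · exact h.1
      · exact absurd h h1

lemma Neighbor.comm {α β : ℕ × ℕ} (h : Neighbor α β) : Neighbor β α := h.symm

lemma IncreasingAt.ne_of_neighbor {S : Set (ℕ × ℕ)} {s : ℤ} {D : ℕ × ℕ → Option ZDot}
    (h : IncreasingAt S s D) {α β : ℕ × ℕ} (hn : Neighbor α β) {u : ZDot} (hα : D α = some u) :
    D β ≠ some u := by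
  intro hβ
  rcases hn with hn | hn
  · exact lt_irrefl _ (h.lt _ _ hn.lt _ _ hα hβ)
  · exact lt_irrefl _ (h.lt _ _ hn.lt _ _ hβ hα)

lemma IncreasingAt.swapDot_swapDot {S : Set (ℕ × ℕ)} {t : ℤ} {D : ℕ × ℕ → Option ZDot}
    (h : IncreasingAt S t D) (s : ℤ) : swapDot s (swapDot s D) = D := by
  funext α
  rcases hα : D α with _ | x | ⟨⟩
  · rw [swapDot_eq_none_iff, swapDot_eq_none_iff, hα]
  · by_cases hx : x = s
    · subst hx
      rw [swapDot_eq_inl_iff, swapDot_eq_inl_iff, swapDot_eq_inr_iff]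
      by_cases hβ : ∃ β, Neighbor α β ∧ D β = some (Sum.inr ())
      · refine Or.inr ⟨Or.inr ⟨hα, hβ⟩, ?_⟩
        obtain ⟨β, hn, hβ⟩ := hβ
        exact ⟨β, hn, (swapDot_eq_inl_iff _ _ _).2 (Or.inr ⟨hβ, α, hn.comm, hα⟩)⟩
      · push Not at hβ
        refine Or.inl ⟨Or.inl ⟨hα, hβ⟩, fun β hn => ?_⟩
        rw [Ne, swapDot_eq_inr_iff]
        rintro (h1 | h1)
        · exact hβ β hn h1.1
        · exact h.ne_of_neighbor hn hα h1.1
    · rw [swapDot_eq_inl_iff_of_ne hx, swapDot_eq_inl_iff_of_ne hx, hα]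
  · rw [swapDot_eq_inr_iff, swapDot_eq_inr_iff, swapDot_eq_inl_iff]
    by_cases hβ : ∃ β, Neighbor α β ∧ D β = some (Sum.inl s)
    · refine Or.inr ⟨Or.inr ⟨hα, hβ⟩, ?_⟩
      obtain ⟨β, hn, hβ⟩ := hβ
      exact ⟨β, hn, (swapDot_eq_inr_iff _ _ _).2 (Or.inr ⟨hβ, α, hn.comm, hα⟩)⟩
    · push Not at hβ
      refine Or.inl ⟨Or.inl ⟨hα, hβ⟩, fun β hn => ?_⟩
      rw [Ne, swapDot_eq_inl_iff]
      rintro (h1 | h1)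
      · exact hβ β hn h1.1
      · exact h.ne_of_neighbor hn hα h1.1

/-- Entries with consecutive levels in comparable boxes occupy neighboring boxes. -/
lemma IncreasingAt.covBy {S : Set (ℕ × ℕ)} {s : ℤ} {D : ℕ × ℕ → Option ZDot}
    (hS : S.OrdConnected) (h : IncreasingAt S s D) {α β : ℕ × ℕ} (hlt : α < β) {u v : ZDot}
    (hα : D α = some u) (hβ : D β = some v) (huv : dotLevel s v = dotLevel s u + 1) :
    α ⋖ β := by
  refine ⟨hlt, fun γ h1 h2 => ?_⟩
  have hγ : γ ∈ S := hS.out ((h.shape α).2 (by simp [hα])) ((h.shape β).2 (by simp [hβ]))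
    ⟨h1.le, h2.le⟩
  obtain ⟨w, hw⟩ := Option.ne_none_iff_exists'.1 ((h.shape γ).1 hγ)
  have := h.lt _ _ h1 _ _ hα hw
  have := h.lt _ _ h2 _ _ hw hβ
  omega

lemma eq_or_of_swapDot_eq_some {s : ℤ} {D : ℕ × ℕ → Option ZDot} {γ : ℕ × ℕ} {w : ZDot}
    (hw : swapDot s D γ = some w) : D γ = some w ∨
      (w = Sum.inl s ∧ D γ = some (Sum.inr ())) ∨ (w = Sum.inr () ∧ D γ = some (Sum.inl s)) := by
  rcases w with x | ⟨⟩
  · by_cases hx : x = s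
    · subst hx
      rcases (swapDot_eq_inl_iff _ _ _).1 hw with h1 | h1
      · exact Or.inl h1.1
      · exact Or.inr (Or.inl ⟨rfl, h1.1⟩)
    · exact Or.inl ((swapDot_eq_inl_iff_of_ne hx _ _).1 hw)
  · rcases (swapDot_eq_inr_iff _ _ _).1 hw with h1 | h1
    · exact Or.inl h1.1
    · exact Or.inr (Or.inr ⟨rfl, h1.1⟩)

lemma IncreasingAt.swapDot_succ {S : Set (ℕ × ℕ)} {s : ℤ} {D : ℕ × ℕ → Option ZDot}
    (hS : S.OrdConnected) (h : IncreasingAt S s D) : IncreasingAt S (s + 1) (swapDot s D) := by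
  refine ⟨fun α => by rw [Ne, swapDot_eq_none_iff]; exact h.shape α, ?_⟩
  intro α β hlt u v hu hv
  have hsw : D α = some (Sum.inr ()) → D β = some (Sum.inl s) →
      swapDot s D α = some (Sum.inl s) ∧ swapDot s D β = some (Sum.inr ()) := by
    intro h1 h2
    have hc := h.covBy hS hlt h1 h2 (by simp)
    exact ⟨(swapDot_eq_inl_iff _ _ _).2 (Or.inr ⟨h1, β, Or.inl hc, h2⟩),
      (swapDot_eq_inr_iff _ _ _).2 (Or.inr ⟨h2, α, Or.inr hc, h1⟩)⟩
  have ku := eq_or_of_swapDot_eq_some hu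
  have kv := eq_or_of_swapDot_eq_some hv
  obtain ⟨u', hu'⟩ : ∃ u', D α = some u' := by
    rcases ku with h1 | h1 | h1
    exacts [⟨_, h1⟩, ⟨_, h1.2⟩, ⟨_, h1.2⟩]
  obtain ⟨v', hv'⟩ : ∃ v', D β = some v' := by
    rcases kv with h1 | h1 | h1
    exacts [⟨_, h1⟩, ⟨_, h1.2⟩, ⟨_, h1.2⟩]
  have hl := h.lt _ _ hlt _ _ hu' hv'
  rw [hu', hu] at hsw
  rw [hv', hv] at hsw
  rw [hu'] at ku
  rw [hv'] at kv
  rcases u with x | ⟨⟩ <;> rcases u' with x' | ⟨⟩ <;> rcases v with y | ⟨⟩ <;>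
    rcases v' with y' | ⟨⟩ <;> simp at hsw hl ku kv ⊢ <;> grind

lemma IncreasingAt.swapDot_pred {S : Set (ℕ × ℕ)} {s : ℤ} {D : ℕ × ℕ → Option ZDot}
    (hS : S.OrdConnected) (h : IncreasingAt S (s + 1) D) : IncreasingAt S s (swapDot s D) := by
  refine ⟨fun α => by rw [Ne, swapDot_eq_none_iff]; exact h.shape α, ?_⟩
  intro α β hlt u v hu hv
  have hsw : D α = some (Sum.inl s) → D β = some (Sum.inr ()) →
      swapDot s D α = some (Sum.inr ()) ∧ swapDot s D β = some (Sum.inl s) := by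
    intro h1 h2
    have hc := h.covBy hS hlt h1 h2 (by simp; ring)
    exact ⟨(swapDot_eq_inr_iff _ _ _).2 (Or.inr ⟨h1, β, Or.inl hc, h2⟩),
      (swapDot_eq_inl_iff _ _ _).2 (Or.inr ⟨h2, α, Or.inr hc, h1⟩)⟩
  have ku := eq_or_of_swapDot_eq_some hu
  have kv := eq_or_of_swapDot_eq_some hv
  obtain ⟨u', hu'⟩ : ∃ u', D α = some u' := by
    rcases ku with h1 | h1 | h1
    exacts [⟨_, h1⟩, ⟨_, h1.2⟩, ⟨_, h1.2⟩]
  obtain ⟨v', hv'⟩ : ∃ v', D β = some v' := by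
    rcases kv with h1 | h1 | h1
    exacts [⟨_, h1⟩, ⟨_, h1.2⟩, ⟨_, h1.2⟩]
  have hl := h.lt _ _ hlt _ _ hu' hv'
  rw [hu', hu] at hsw
  rw [hv', hv] at hsw
  rw [hu'] at ku
  rw [hv'] at kv
  rcases u with x | ⟨⟩ <;> rcases u' with x' | ⟨⟩ <;> rcases v with y | ⟨⟩ <;>
    rcases v' with y' | ⟨⟩ <;> simp at hsw hl ku kv ⊢ <;> grind

/-- `T'` is obtained from `T` by a forward slide inside the region `S`; the boxes of `S` outside
`T` are the starting boxes of the slide, and those outside `T'` are its final boxes. -/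
structure IsSlideIn (S : Set (ℕ × ℕ)) (T T' : ℕ × ℕ → Option ℤ) : Prop where
  finite : S.Finite
  ordConnected : S.OrdConnected
  mem_left : ∀ {α x}, T α = some x → α ∈ S
  mem_right : ∀ {α x}, T' α = some x → α ∈ S
  minimal : ∀ {α β}, α ∈ S → T α = none → β ∈ S → ¬ β < α
  maximal : ∀ {α β}, α ∈ S → T' α = none → β ∈ S → ¬ α < β
  increasing_left : Increasing T
  increasing_right : Increasing T'
  source : ∀ {α x}, T α = some x → T' α = some x ∨ ∃ β, β ⋖ α ∧ T' β = some x
  target : ∀ {α x}, T' α = some x → T α = some x ∨ ∃ β, α ⋖ β ∧ T β = some x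
  le : ∀ {α β v}, α ∈ S → α ⋖ β → T β = some v → ∃ u, u ≤ v ∧ T' α = some u

/-- `T'` is obtained from `T` by a forward slide. -/
def Slide (T T' : ℕ × ℕ → Option ℤ) : Prop := ∃ S, IsSlideIn S T T'

lemma restrictInt_eq_some {D : ℕ × ℕ → Option ZDot} {α : ℕ × ℕ} {x : ℤ} :
    restrictInt D α = some x ↔ D α = some (Sum.inl x) := by
  unfold restrictInt
  rcases D α with _ | x | ⟨⟩ <;> simp

lemma restrictInt_eq_none {D : ℕ × ℕ → Option ZDot} {α : ℕ × ℕ} :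
    restrictInt D α = none ↔ D α = none ∨ D α = some (Sum.inr ()) := by
  unfold restrictInt
  rcases D α with _ | x | ⟨⟩ <;> simp

lemma IncreasingAt.increasing {S : Set (ℕ × ℕ)} {s : ℤ} {D : ℕ × ℕ → Option ZDot}
    (h : IncreasingAt S s D) : Increasing (restrictInt D) := by
  intro α β hlt x y hx hy
  have := h.lt _ _ hlt _ _ (restrictInt_eq_some.1 hx) (restrictInt_eq_some.1 hy)
  simp at this
  exact this

/-- Applying `swap_{a,•}, …, swap_{a+N-1,•}` from `D 0` gives `D N`. -/
structure IsStaged (S : Set (ℕ × ℕ)) (a : ℤ) (N : ℕ) (D : ℕ → ℕ × ℕ → Option ZDot) : Prop where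
  step : ∀ n < N, D (n + 1) = swapDot (a + n) (D n)
  incr : ∀ n ≤ N, IncreasingAt S (a + n) (D n)

lemma IsStaged.eq_inl_iff {S : Set (ℕ × ℕ)} {a : ℤ} {N : ℕ} {D : ℕ → ℕ × ℕ → Option ZDot}
    (h : IsStaged S a N D) {m n : ℕ} (hmn : m ≤ n) (hn : n ≤ N) {x : ℤ}
    (hx : x < a + m ∨ a + n ≤ x) (α : ℕ × ℕ) :
    D n α = some (Sum.inl x) ↔ D m α = some (Sum.inl x) := by
  induction n, hmn using Nat.le_induction with
  | base => rfl
  | succ n hmn ih =>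
    rw [h.step n (by omega), swapDot_eq_inl_iff_of_ne (by push_cast at hx; omega)]
    exact ih (by omega) (by push_cast at hx; omega)

lemma IsStaged.isSlideIn {S : Set (ℕ × ℕ)} (hfin : S.Finite) (hS : S.OrdConnected) {a : ℤ} {N : ℕ}
    {D : ℕ → ℕ × ℕ → Option ZDot} (h : IsStaged S a N D)
    (hv : ∀ α x, D 0 α = some (Sum.inl x) → a ≤ x ∧ x < a + N) :
    IsSlideIn S (restrictInt (D 0)) (restrictInt (D N)) := by
  have hv' : ∀ α x, D N α = some (Sum.inl x) → a ≤ x ∧ x < a + N := by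
    intro α x hx
    by_contra hc
    exact hc (hv α x ((h.eq_inl_iff (Nat.zero_le N) le_rfl (by push_cast; omega) α).1 hx))
  have h0 := h.incr 0 (Nat.zero_le N)
  have hN := h.incr N le_rfl
  have key : ∀ x, a ≤ x → x < a + N → ∃ D', IncreasingAt S x D' ∧
      (∀ α, restrictInt (D 0) α = some x ↔ D' α = some (Sum.inl x)) ∧
      (∀ α y, y < x → D' α = some (Sum.inl y) → restrictInt (D N) α = some y) ∧
      (∀ α, restrictInt (D N) α = some x ↔ swapDot x D' α = some (Sum.inl x)) := by
    intro x h1 h2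
    obtain ⟨n, rfl⟩ : ∃ n : ℕ, x = a + n := ⟨(x - a).toNat, by omega⟩
    refine ⟨D n, h.incr n (by omega), fun α => ?_, fun α y hy hD => ?_, fun α => ?_⟩
    · rw [restrictInt_eq_some]
      exact (h.eq_inl_iff (Nat.zero_le n) (by omega) (by omega) α).symm
    · rw [restrictInt_eq_some]
      exact (h.eq_inl_iff (show n ≤ N by omega) le_rfl (by omega) α).2 hD
    · rw [restrictInt_eq_some, ← h.step n (by omega)]
      exact h.eq_inl_iff (show n + 1 ≤ N by omega) le_rfl (by push_cast; omega) α
  refine ⟨hfin, hS, fun hα => ?_, fun hα => ?_, fun {α β} hα hT hβ hlt => ?_,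
    fun {α β} hα hT hβ hlt => ?_, h0.increasing, hN.increasing, fun {α x} hT => ?_,
    fun {α x} hT => ?_, fun {α β v} hα hc hT => ?_⟩
  · exact (h0.shape _).2 (by simp [restrictInt_eq_some.1 hα])
  · exact (hN.shape _).2 (by simp [restrictInt_eq_some.1 hα])
  · have hα' : D 0 α = some (Sum.inr ()) :=
      (restrictInt_eq_none.1 hT).resolve_left ((h0.shape α).1 hα)
    obtain ⟨u, hu⟩ := Option.ne_none_iff_exists'.1 ((h0.shape β).1 hβ)
    have := h0.lt _ _ hlt _ _ hu hα'
    rcases u with x | ⟨⟩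
    · have := hv _ _ hu
      simp at *; omega
    · simp at this
  · have hα' : D N α = some (Sum.inr ()) :=
      (restrictInt_eq_none.1 hT).resolve_left ((hN.shape α).1 hα)
    obtain ⟨u, hu⟩ := Option.ne_none_iff_exists'.1 ((hN.shape β).1 hβ)
    have := hN.lt _ _ hlt _ _ hα' hu
    rcases u with x | ⟨⟩
    · have := hv' _ _ hu
      simp at *; omega
    · simp at this
  · obtain ⟨D', hD, k1, k2, k3⟩ := key x (hv _ _ (restrictInt_eq_some.1 hT)).1
      (hv _ _ (restrictInt_eq_some.1 hT)).2
    by_cases hβ : ∃ β, Neighbor α β ∧ D' β = some (Sum.inr ())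
    · obtain ⟨β, hn, hβ⟩ := hβ
      have hα := (k1 α).1 hT
      refine Or.inr ⟨β, ?_, (k3 β).2 ((swapDot_eq_inl_iff _ _ _).2 (Or.inr ⟨hβ, α, hn.comm, hα⟩))⟩
      rcases hn with hn | hn
      · have := hD.lt _ _ hn.lt _ _ hα hβ
        simp at this; omega
      · exact hn
    · push Not at hβ
      exact Or.inl ((k3 α).2 ((swapDot_eq_inl_iff _ _ _).2 (Or.inl ⟨(k1 α).1 hT, hβ⟩)))
  · obtain ⟨D', hD, k1, k2, k3⟩ := key x (hv' _ _ (restrictInt_eq_some.1 hT)).1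
      (hv' _ _ (restrictInt_eq_some.1 hT)).2
    rcases (swapDot_eq_inl_iff _ _ _).1 ((k3 α).1 hT) with h1 | ⟨h1, β, hn, hβ⟩
    · exact Or.inl ((k1 α).2 h1.1)
    · refine Or.inr ⟨β, ?_, (k1 β).2 hβ⟩
      rcases hn with hn | hn
      · exact hn
      · have := hD.lt _ _ hn.lt _ _ hβ h1
        simp at this; omega
  · obtain ⟨D', hD, k1, k2, k3⟩ := key v (hv _ _ (restrictInt_eq_some.1 hT)).1
      (hv _ _ (restrictInt_eq_some.1 hT)).2
    obtain ⟨u, hu⟩ := Option.ne_none_iff_exists'.1 ((hD.shape α).1 hα)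
    have := hD.lt _ _ hc.lt _ _ hu ((k1 β).1 hT)
    rcases u with x | ⟨⟩
    · simp at this
      exact ⟨x, this.le, k2 α x this hu⟩
    · exact ⟨v, le_rfl, (k3 α).2 ((swapDot_eq_inl_iff _ _ _).2
        (Or.inr ⟨hu, β, Or.inl hc, (k1 β).1 hT⟩))⟩

lemma toDotted_eq_some {T : ℕ × ℕ → Option ℤ} {α : ℕ × ℕ} {u : ZDot} :
    toDotted T α = some u ↔ ∃ x, T α = some x ∧ u = Sum.inl x := by
  unfold toDotted
  rcases T α with _ | x <;> simp [eq_comm]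

lemma toDotted_eq_none {T : ℕ × ℕ → Option ℤ} {α : ℕ × ℕ} :
    toDotted T α = none ↔ T α = none := by
  unfold toDotted
  rcases T α with _ | x <;> simp

lemma restrictInt_addDots {C : Finset (ℕ × ℕ)} {T : ℕ × ℕ → Option ℤ}
    (h : ∀ c ∈ C, T c = none) : restrictInt (addDots C (toDotted T)) = T := by
  funext α
  by_cases hα : α ∈ C
  · simp [restrictInt, addDots, hα, h α hα]
  · rcases hT : T α with _ | x <;> simp [restrictInt, addDots, hα, toDotted, hT]

/-- Placing dots below or above all entries of an increasing tableau. -/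
lemma increasingAt_addDots {S : Set (ℕ × ℕ)} {s : ℤ} {C : Finset (ℕ × ℕ)}
    {T : ℕ × ℕ → Option ℤ} (hT : Increasing T)
    (hS : ∀ α, α ∈ S ↔ α ∈ C ∨ T α ≠ none)
    (hanti : ∀ c ∈ C, ∀ d ∈ C, ¬ c < d)
    (hlt : ∀ c ∈ C, ∀ α x, α < c → T α = some x → x < s)
    (hgt : ∀ c ∈ C, ∀ α x, c < α → T α = some x → s ≤ x) :
    IncreasingAt S s (addDots C (toDotted T)) := by
  refine ⟨fun α => ?_, fun α β hαβ u v hu hv => ?_⟩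
  · rw [hS]
    by_cases hα : α ∈ C <;> simp [addDots, hα, toDotted_eq_none]
  · by_cases hα : α ∈ C <;> by_cases hβ : β ∈ C <;>
      simp only [addDots, hα, hβ, if_true, if_false, Option.some.injEq, toDotted_eq_some] at hu hv
    · exact absurd hαβ (hanti _ hα _ hβ)
    · obtain ⟨y, hy, rfl⟩ := hv
      subst hu
      have := hgt _ hα _ _ hαβ hy
      simp; omega
    · obtain ⟨x, hx, rfl⟩ := hu
      subst hv
      have := hlt _ hβ _ _ hαβ hx
      simp; omega
    · obtain ⟨x, hx, rfl⟩ := hu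
      obtain ⟨y, hy, rfl⟩ := hv
      have := hT _ _ hαβ _ _ hx hy
      simp; omega

lemma StraightShape.ordConnected_diff {lam nu : Finset (ℕ × ℕ)} (h1 : StraightShape lam)
    (h2 : StraightShape nu) : ((nu : Set (ℕ × ℕ)) \ lam).OrdConnected := by
  refine ⟨fun α hα β hβ γ hγ => ⟨?_, fun h => hα.2 ?_⟩⟩
  · exact h2 _ hβ.1 _ hγ.2
  · exact h1 _ h _ hγ.1

lemma isStaged_swapUp {S : Set (ℕ × ℕ)} (hS : S.OrdConnected) {a : ℤ}
    {D : ℕ × ℕ → Option ZDot} (h : IncreasingAt S a D) (N : ℕ) :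
    IsStaged S a N (fun n => swapUp a n D) := by
  refine ⟨fun n _ => rfl, fun n _ => ?_⟩
  induction n with
  | zero => simpa [swapUp] using h
  | succ n ih =>
    have := (ih (by omega)).swapDot_succ hS
    rw [add_assoc] at this
    exact_mod_cast this

lemma increasingAt_swapDown {S : Set (ℕ × ℕ)} (hS : S.OrdConnected) {b : ℤ}
    {D : ℕ × ℕ → Option ZDot} (h : IncreasingAt S (b + 1) D) (n : ℕ) :
    IncreasingAt S (b + 1 - n) (swapDown b n D) := by
  induction n with
  | zero => simpa [swapDown] using h
  | succ n ih =>
    have h1 : b + 1 - n = (b - n) + 1 := by ring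
    have h2 : b + 1 - ((n + 1 : ℕ) : ℤ) = b - n := by push_cast; ring
    rw [h1] at ih
    rw [h2]
    exact ih.swapDot_pred hS

lemma isStaged_swapDown {S : Set (ℕ × ℕ)} (hS : S.OrdConnected) {b : ℤ}
    {D : ℕ × ℕ → Option ZDot} (h : IncreasingAt S (b + 1) D) (N : ℕ) :
    IsStaged S (b + 1 - N) N (fun n => swapDown b (N - n) D) := by
  refine ⟨fun n hn => ?_, fun n hn => ?_⟩
  · obtain ⟨m, rfl⟩ : ∃ m, N = n + m + 1 := ⟨N - n - 1, by omega⟩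
    have h1 : n + m + 1 - n = m + 1 := by omega
    have h2 : n + m + 1 - (n + 1) = m := by omega
    have h3 : b + 1 - ((n + m + 1 : ℕ) : ℤ) + n = b - m := by push_cast; ring
    simp only [h1, h2, h3]
    exact ((increasingAt_swapDown hS h m).swapDot_swapDot (b - m)).symm
  · have := increasingAt_swapDown hS h (N - n)
    rwa [show b + 1 - ((N - n : ℕ) : ℤ) = b + 1 - N + n by push_cast [hn]; ring] at this

lemma IsStaged.swapDown_eq {S : Set (ℕ × ℕ)} {a : ℤ} {N : ℕ} {D : ℕ → ℕ × ℕ → Option ZDot}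
    (h : IsStaged S a N D) {n : ℕ} (hn : n ≤ N) :
    swapDown (a + N - 1) n (D N) = D (N - n) := by
  induction n with
  | zero => rfl
  | succ n ih =>
    obtain ⟨m, rfl⟩ : ∃ m, N = n + m + 1 := ⟨N - n - 1, by omega⟩
    have h1 : n + m + 1 - n = m + 1 := by omega
    have h2 : n + m + 1 - (n + 1) = m := by omega
    have h3 : a + ((n + m + 1 : ℕ) : ℤ) - 1 - n = a + m := by push_cast; ring
    rw [h2]
    show swapDot _ (swapDown _ _ _) = _
    rw [ih (by omega), h1, h3, h.step m (by omega)]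
    exact (h.incr m (by omega)).swapDot_swapDot _

lemma IsForwardSlide.slide {T T' : ℕ × ℕ → Option ℤ} (h : IsForwardSlide T T')
    (hT : Increasing T) : Slide T T' := by
  obtain ⟨lam, nu, C, a, b, ⟨h1, h2, h3⟩, hsh, hv, hC, rfl⟩ := h
  have hsh' : ∀ α, T α ≠ none ↔ α ∈ nu ∧ α ∉ lam := fun α => by
    have := Set.ext_iff.1 hsh α
    simpa [shapeOf] using this
  have hlam : StraightShape (lam \ C) := by
    intro x hx y hy
    rw [Finset.mem_sdiff] at hx ⊢
    refine ⟨h1 _ hx.1 _ hy, fun hyC => ?_⟩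
    rcases hy.lt_or_eq with hlt | rfl
    · exact (hC _ hyC).2 _ hx.1 hlt
    · exact hx.2 hyC
  have hS := hlam.ordConnected_diff h2
  have hD : IncreasingAt ((nu : Set (ℕ × ℕ)) \ (lam \ C : Finset (ℕ × ℕ))) a
      (addDots C (toDotted T)) := by
    refine increasingAt_addDots hT (fun α => ?_) (fun c hc d hd => (hC c hc).2 d (hC d hd).1)
      (fun c hc α x hlt hx => ?_) (fun c hc α x hlt hx => (hv _ _ hx).1)
    · rw [hsh']
      simp only [Set.mem_sdiff, Finset.mem_coe, Finset.mem_sdiff]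
      have : α ∈ C → α ∈ lam := fun h => (hC _ h).1
      have := @h3 α
      tauto
    · exact absurd (h1 _ (hC _ hc).1 _ hlt.le) ((hsh' α).1 (by simp [hx])).2
  refine ⟨(nu : Set (ℕ × ℕ)) \ (lam \ C : Finset (ℕ × ℕ)), ?_⟩
  have := (isStaged_swapUp hS hD (b - a + 1).toNat).isSlideIn
    (nu.finite_toSet.subset Set.sdiff_subset) hS (fun α x hx => ?_)
  · rwa [show swapUp a 0 (addDots C (toDotted T)) = addDots C (toDotted T) from rfl,
      restrictInt_addDots] at this
    intro c hc
    by_contra hne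
    exact ((hsh' c).1 hne).2 (hC _ hc).1
  · have hx' : restrictInt (addDots C (toDotted T)) α = some x := restrictInt_eq_some.2 hx
    rw [restrictInt_addDots] at hx'
    · have := hv _ _ hx'
      omega
    intro c hc
    by_contra hne
    exact ((hsh' c).1 hne).2 (hC _ hc).1

lemma IsReverseSlide.slide {T T' : ℕ × ℕ → Option ℤ} (h : IsReverseSlide T T')
    (hT : Increasing T) : Slide T' T := by
  obtain ⟨lam, nu, C, a, b, ⟨h1, h2, h3⟩, hsh, hv, hC, rfl⟩ := h
  have hsh' : ∀ α, T α ≠ none ↔ α ∈ nu ∧ α ∉ lam := fun α => by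
    have := Set.ext_iff.1 hsh α
    simpa [shapeOf] using this
  have hnu : StraightShape (nu ∪ C) := by
    intro x hx y hy
    rw [Finset.mem_union] at hx ⊢
    rcases hx with hx | hx
    · exact Or.inl (h2 _ hx _ hy)
    · by_contra! hc
      rcases hy.lt_or_eq with hlt | rfl
      · exact (hC _ hx).2 _ hc.1 hlt
      · exact hc.2 hx
  have hS := h1.ordConnected_diff hnu
  have hCn : ∀ c ∈ C, T c = none := by
    intro c hc
    by_contra hne
    exact (hC _ hc).1 ((hsh' c).1 hne).1
  have hD : IncreasingAt (((nu ∪ C : Finset (ℕ × ℕ)) : Set (ℕ × ℕ)) \ lam) (b + 1)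
      (addDots C (toDotted T)) := by
    refine increasingAt_addDots hT (fun α => ?_) (fun c hc d hd => (hC d hd).2 c (hC c hc).1)
      (fun c hc α x hlt hx => by have := (hv _ _ hx).2; omega) (fun c hc α x hlt hx => ?_)
    · rw [hsh']
      simp only [Set.mem_sdiff, Finset.mem_coe, Finset.mem_union]
      have : α ∈ C → α ∉ nu := fun h => (hC _ h).1
      have := @h3 α
      tauto
    · exact absurd (h2 _ ((hsh' α).1 (by simp [hx])).1 _ hlt.le) (hC _ hc).1
  refine ⟨((nu ∪ C : Finset (ℕ × ℕ)) : Set (ℕ × ℕ)) \ lam, ?_⟩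
  have hst := isStaged_swapDown hS hD (b - a + 1).toNat
  have := hst.isSlideIn ((nu ∪ C).finite_toSet.subset Set.sdiff_subset) hS (fun α x hx => ?_)
  · simpa [swapDown, restrictInt_addDots hCn] using this
  · by_contra hc
    have hx' := (hst.eq_inl_iff (Nat.zero_le _) le_rfl (by push_cast at hc ⊢; omega) α).2 hx
    rw [← restrictInt_eq_some] at hx'
    simp only [Nat.sub_self, swapDown, restrictInt_addDots hCn] at hx'
    have := hv _ _ hx'
    omega

lemma IsSlideIn.right_unique {S : Set (ℕ × ℕ)} {T T₁ T₂ : ℕ × ℕ → Option ℤ}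
    (h₁ : IsSlideIn S T T₁) (h₂ : IsSlideIn S T T₂) : T₁ = T₂ := by
  have aux : ∀ {T₁ T₂ : ℕ × ℕ → Option ℤ}, IsSlideIn S T T₁ → IsSlideIn S T T₂ → ∀ α,
      (∀ β < α, T₁ β = T₂ β) → ∀ y, T₁ α = some y → ∃ z ≤ y, T₂ α = some z := by
    intro T₁ T₂ h₁ h₂ α ih y hy
    rcases h₁.target hy with hT | ⟨β, hc, hT⟩
    · rcases h₂.source hT with hT₂ | ⟨β, hc, hT₂⟩
      · exact ⟨y, le_rfl, hT₂⟩
      · rw [← ih β hc.lt] at hT₂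
        exact absurd (h₁.increasing_right _ _ hc.lt _ _ hT₂ hy) (lt_irrefl _)
    · exact h₂.le (h₁.mem_right hy) hc hT
  funext α
  induction α using WellFoundedLT.induction with
  | ind α ih =>
    rcases e₁ : T₁ α with _ | y <;> rcases e₂ : T₂ α with _ | z
    · rfl
    · obtain ⟨w, -, hw⟩ := aux h₂ h₁ α (fun β hβ => (ih β hβ).symm) z e₂
      simp [e₁] at hw
    · obtain ⟨w, -, hw⟩ := aux h₁ h₂ α ih y e₁
      simp [e₂] at hw
    · obtain ⟨w, hwz, hw⟩ := aux h₂ h₁ α (fun β hβ => (ih β hβ).symm) z e₂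
      obtain ⟨w', hwy, hw'⟩ := aux h₁ h₂ α ih y e₁
      rw [e₁] at hw
      rw [e₂] at hw'
      simp at hw hw' ⊢
      omega

lemma Set.Finite.exists_valuesIn {S : Set (ℕ × ℕ)} (hS : S.Finite) {T : ℕ × ℕ → Option ℤ}
    (hT : ∀ {α x}, T α = some x → α ∈ S) : ∃ a b, ValuesIn T a b ∧ a ≤ b := by
  have hf : ((fun α => (T α).getD 0) '' S).Finite := hS.image _
  obtain ⟨a, ha⟩ := hf.bddBelow
  obtain ⟨b, hb⟩ := hf.bddAbove
  refine ⟨min a 0, max b 0, fun α x hx => ?_, by simp⟩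
  have hm : x ∈ (fun α => (T α).getD 0) '' S := ⟨α, hT hx, by simp [hx]⟩
  have := ha hm
  have := hb hm
  simp; omega

lemma Set.Finite.exists_straightShape {S : Set (ℕ × ℕ)} (hS : S.Finite) :
    ∃ nu : Finset (ℕ × ℕ), StraightShape nu ∧ ∀ α, α ∈ nu ↔ ∃ β ∈ S, α ≤ β := by
  refine ⟨hS.toFinset.biUnion Finset.Iic, fun α hα β hβ => ?_, fun α => by simp⟩
  simp only [Finset.mem_biUnion, Set.Finite.mem_toFinset, Finset.mem_Iic] at hα ⊢
  obtain ⟨γ, hγ, hαγ⟩ := hα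
  exact ⟨γ, hγ, hβ.trans hαγ⟩

lemma IsSlideIn.slides {S : Set (ℕ × ℕ)} {T T' : ℕ × ℕ → Option ℤ} (h : IsSlideIn S T T') :
    IsForwardSlide T T' ∧ IsReverseSlide T' T := by
  obtain ⟨nu, hnu, mem_nu⟩ := h.finite.exists_straightShape
  obtain ⟨a, b, hv, hab⟩ := h.finite.exists_valuesIn h.mem_left
  have hSnu : ∀ {α}, α ∈ S → α ∈ nu := fun {α} hα => (mem_nu α).2 ⟨α, hα, le_rfl⟩
  have hdown : ∀ {α β}, α ∈ nu → α ∉ S → β ≤ α → β ∉ S := by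
    intro α β hα hαS hβ hβS
    obtain ⟨γ, hγ, hαγ⟩ := (mem_nu α).1 hα
    exact hαS (h.ordConnected.out hβS hγ ⟨hβ, hαγ⟩)
  set C := h.finite.toFinset.filter fun α => T α = none with hC
  set C' := h.finite.toFinset.filter fun α => T' α = none with hC'
  have mem_C : ∀ α, α ∈ C ↔ α ∈ S ∧ T α = none := fun α => by simp [hC]
  have mem_C' : ∀ α, α ∈ C' ↔ α ∈ S ∧ T' α = none := fun α => by simp [hC']
  set lam := nu.filter fun α => T α = none with hlam
  have mem_lam : ∀ α, α ∈ lam ↔ α ∈ nu ∧ T α = none := fun α => by simp [hlam]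
  have hTS : ∀ {α}, T α ≠ none → α ∈ S := by
    intro α hα
    obtain ⟨x, hx⟩ := Option.ne_none_iff_exists'.1 hα
    exact h.mem_left hx
  have hTS' : ∀ {α}, T' α ≠ none → α ∈ S := by
    intro α hα
    obtain ⟨x, hx⟩ := Option.ne_none_iff_exists'.1 hα
    exact h.mem_right hx
  have hD : IncreasingAt S a (addDots C (toDotted T)) := by
    refine increasingAt_addDots h.increasing_left (fun α => ?_)
      (fun c hc d hd => h.minimal ((mem_C d).1 hd).1 ((mem_C d).1 hd).2 ((mem_C c).1 hc).1)
      (fun c hc α x hlt hx => absurd hlt (h.minimal ((mem_C c).1 hc).1 ((mem_C c).1 hc).2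
        (h.mem_left hx))) (fun c hc α x hlt hx => (hv _ _ hx).1)
    rw [mem_C]
    have := @hTS α
    tauto
  have hr : restrictInt (addDots C (toDotted T)) = T :=
    restrictInt_addDots fun c hc => ((mem_C c).1 hc).2
  set N := (b - a + 1).toNat with hN
  have hst := isStaged_swapUp h.ordConnected hD N
  have hsl := hst.isSlideIn h.finite h.ordConnected (fun α x hx => by
    have hx' : restrictInt (addDots C (toDotted T)) α = some x := restrictInt_eq_some.2 hx
    rw [hr] at hx'
    have := hv _ _ hx'
    omega)
  have hvalN : ∀ α x, swapUp a N (addDots C (toDotted T)) α = some (Sum.inl x) →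
      a ≤ x ∧ x ≤ b := by
    intro α x hx
    by_contra hc
    have hx' := (hst.eq_inl_iff (Nat.zero_le N) le_rfl (by push_cast; omega) α).1 hx
    rw [← restrictInt_eq_some] at hx'
    simp only [swapUp, hr] at hx'
    exact hc (hv _ _ hx')
  simp only [swapUp, hr] at hsl
  have hT' := h.right_unique hsl
  constructor
  · refine ⟨lam, nu, C, a, b, ⟨fun α hα β hβ => ?_, hnu, Finset.filter_subset _ _⟩, ?_, hv,
      fun c hc => ⟨(mem_lam c).2 ⟨hSnu ((mem_C c).1 hc).1, ((mem_C c).1 hc).2⟩,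
        fun d hd hlt => ?_⟩, hT'⟩
    · rw [mem_lam] at hα ⊢
      refine ⟨hnu _ hα.1 _ hβ, by_contra fun hne => ?_⟩
      by_cases hαS : α ∈ S
      · rcases hβ.lt_or_eq with hlt | rfl
        · exact h.minimal hαS hα.2 (hTS hne) hlt
        · exact hne hα.2
      · exact hdown hα.1 hαS hβ (hTS hne)
    · ext α
      simp only [shapeOf, Set.mem_ofPred_eq, Set.mem_sdiff, Finset.mem_coe, mem_lam]
      have := @hTS α
      have := @hSnu α
      tauto
    · rw [mem_lam] at hd
      rw [mem_C] at hc
      by_cases hdS : d ∈ S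
      · exact h.minimal hdS hd.2 hc.1 hlt
      · exact hdown hd.1 hdS hlt.le hc.1
  · have hCN : addDots C' (toDotted T') = swapUp a N (addDots C (toDotted T)) := by
      funext α
      have hs := ((hst.incr N le_rfl).shape α)
      rcases e : swapUp a N (addDots C (toDotted T)) α with _ | x | ⟨⟩
      · have hαS : α ∉ S := by rw [hs]; simp [e]
        have : T' α = none := by rw [hT', restrictInt_eq_none]; exact Or.inl e
        simp [addDots, mem_C', hαS, toDotted, this]
      · have : T' α = some x := by rw [hT', restrictInt_eq_some]; exact e
        simp [addDots, mem_C', toDotted, this]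
      · have hαS : α ∈ S := by rw [hs]; simp [e]
        have : T' α = none := by rw [hT', restrictInt_eq_none]; exact Or.inr e
        simp [addDots, mem_C', hαS, this]
    refine ⟨nu.filter (· ∉ S), nu.filter (· ∉ C'), C', a, b, ⟨fun α hα β hβ => ?_,
      fun α hα β hβ => ?_, fun α hα => ?_⟩, ?_, fun α x hx => ?_, fun c hc => ⟨?_, ?_⟩, ?_⟩
    · simp only [Finset.mem_filter] at hα ⊢
      exact ⟨hnu _ hα.1 _ hβ, hdown hα.1 hα.2 hβ⟩
    · simp only [Finset.mem_filter, mem_C'] at hα ⊢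
      refine ⟨hnu _ hα.1 _ hβ, fun hβ' => ?_⟩
      by_cases hαS : α ∈ S
      · rcases hβ.lt_or_eq with hlt | rfl
        · exact h.maximal hβ'.1 hβ'.2 hαS hlt
        · exact hα.2 hβ'
      · exact hdown hα.1 hαS hβ hβ'.1
    · simp only [Finset.mem_filter, mem_C'] at hα ⊢
      tauto
    · ext α
      simp only [shapeOf, Set.mem_ofPred_eq, Set.mem_sdiff, Finset.mem_coe, Finset.mem_filter,
        mem_C']
      have := @hTS' α
      have := @hSnu α
      tauto
    · rw [hT', restrictInt_eq_some] at hx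
      exact hvalN _ _ hx
    · simp [hc]
    · intro d hd hlt
      have hcS := ((mem_C' c).1 hc).1
      have hdC : d ∈ C' := by
        by_contra hne
        exact hd (Finset.mem_filter.2 ⟨hnu _ (hSnu hcS) _ hlt.le, hne⟩)
      exact h.maximal ((mem_C' d).1 hdC).1 ((mem_C' d).1 hdC).2 hcS hlt
    · rw [hCN, show b = a + N - 1 by omega, show (a + N - 1 - a + 1).toNat = N by omega]
      have := hst.swapDown_eq le_rfl
      simp only [Nat.sub_self] at this
      rw [this]
      exact hr.symm

lemma hasSkewShape_of_ordConnected {T : ℕ × ℕ → Option ℤ} (h1 : (shapeOf T).Finite)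
    (h2 : (shapeOf T).OrdConnected) : HasSkewShape T := by
  obtain ⟨nu, hnu, mem_nu⟩ := h1.exists_straightShape
  refine ⟨nu.filter (· ∉ shapeOf T), nu, ⟨fun α hα β hβ => ?_, hnu, Finset.filter_subset _ _⟩, ?_⟩
  · simp only [Finset.mem_filter] at hα ⊢
    refine ⟨hnu _ hα.1 _ hβ, fun hβS => ?_⟩
    obtain ⟨γ, hγ, hαγ⟩ := (mem_nu α).1 hα.1
    exact hα.2 (h2.out hβS hγ ⟨hβ, hαγ⟩)
  · ext α
    simp only [Set.mem_sdiff, Finset.mem_coe, Finset.mem_filter]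
    have : α ∈ shapeOf T → α ∈ nu := fun hα => (mem_nu α).2 ⟨α, hα, le_rfl⟩
    tauto

lemma HasSkewShape.finite {T : ℕ × ℕ → Option ℤ} (h : HasSkewShape T) : (shapeOf T).Finite := by
  obtain ⟨lam, nu, -, h⟩ := h
  rw [h]
  exact nu.finite_toSet.subset Set.sdiff_subset

lemma HasSkewShape.ordConnected {T : ℕ × ℕ → Option ℤ} (h : HasSkewShape T) :
    (shapeOf T).OrdConnected := by
  obtain ⟨lam, nu, ⟨h1, h2, -⟩, h⟩ := h
  rw [h]
  exact h1.ordConnected_diff h2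

lemma mem_shapeOf_iff {T : ℕ × ℕ → Option ℤ} {α : ℕ × ℕ} :
    α ∈ shapeOf T ↔ ∃ x, T α = some x := Option.ne_none_iff_exists'

lemma IsSlideIn.skew {S : Set (ℕ × ℕ)} {T T' : ℕ × ℕ → Option ℤ} (h : IsSlideIn S T T') :
    IncreasingSkewTableau T ∧ IncreasingSkewTableau T' := by
  refine ⟨⟨hasSkewShape_of_ordConnected (h.finite.subset fun α hα => ?_)
    ⟨fun α hα β hβ γ hγ hn => ?_⟩, h.increasing_left⟩,
    ⟨hasSkewShape_of_ordConnected (h.finite.subset fun α hα => ?_)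
    ⟨fun α hα β hβ γ hγ hn => ?_⟩, h.increasing_right⟩⟩
  · obtain ⟨x, hx⟩ := mem_shapeOf_iff.1 hα
    exact h.mem_left hx
  · obtain ⟨x, hx⟩ := mem_shapeOf_iff.1 hα
    obtain ⟨y, hy⟩ := mem_shapeOf_iff.1 hβ
    have hγS := h.ordConnected.out (h.mem_left hx) (h.mem_left hy) hγ
    rcases hγ.1.lt_or_eq with hlt | rfl
    · exact h.minimal hγS hn (h.mem_left hx) hlt
    · exact hα hn
  · obtain ⟨x, hx⟩ := mem_shapeOf_iff.1 hα
    exact h.mem_right hx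
  · obtain ⟨x, hx⟩ := mem_shapeOf_iff.1 hα
    obtain ⟨y, hy⟩ := mem_shapeOf_iff.1 hβ
    have hγS := h.ordConnected.out (h.mem_right hx) (h.mem_right hy) hγ
    rcases hγ.2.lt_or_eq with hlt | rfl
    · exact h.maximal hγS hn (h.mem_right hy) hlt
    · exact hβ hn

/-- The equivalence relation generated by slides. -/
abbrev SlideEquiv : (ℕ × ℕ → Option ℤ) → (ℕ × ℕ → Option ℤ) → Prop := Relation.EqvGen Slide

lemma SlideEquiv.jdtEquiv {T T' : ℕ × ℕ → Option ℤ} (h : SlideEquiv T T') :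
    JdtEquiv T T' ∧ JdtEquiv T' T := by
  induction h with
  | rel T T' h =>
    obtain ⟨S, h⟩ := h
    exact ⟨.single (Or.inl h.slides.1), .single (Or.inr h.slides.2)⟩
  | refl T => exact ⟨.refl, .refl⟩
  | symm T T' _ ih => exact ih.symm
  | trans T T' T'' _ _ ih1 ih2 => exact ⟨ih1.1.trans ih2.1, ih2.2.trans ih1.2⟩

lemma SlideEquiv.skew_iff {T T' : ℕ × ℕ → Option ℤ} (h : SlideEquiv T T') :
    IncreasingSkewTableau T ↔ IncreasingSkewTableau T' := by
  induction h with
  | rel T T' h =>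
    obtain ⟨S, h⟩ := h
    exact iff_of_true h.skew.1 h.skew.2
  | refl T => rfl
  | symm T T' _ ih => exact ih.symm
  | trans T T' T'' _ _ ih1 ih2 => exact ih1.trans ih2

lemma JdtEquiv.slideEquiv {T T' : ℕ × ℕ → Option ℤ} (h : JdtEquiv T T')
    (hT : IncreasingSkewTableau T) : SlideEquiv T T' := by
  induction h with
  | refl => exact .refl _
  | tail _ h ih =>
    have hinc := (ih.skew_iff.1 hT).2
    refine ih.trans _ _ _ ?_
    rcases h with h | h
    · exact .rel _ _ (h.slide hinc)
    · exact .symm _ _ (.rel _ _ (h.slide hinc))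

namespace KKnuth

lemma rfl' (w : List ℤ) : KKnuth w w := .refl _

lemma symm' {w w' : List ℤ} (h : KKnuth w w') : KKnuth w' w := .symm _ _ h

lemma trans' {w w' w'' : List ℤ} (h : KKnuth w w') (h' : KKnuth w' w'') : KKnuth w w'' :=
  .trans _ _ _ h h'

lemma map_rel {f : List ℤ → List ℤ} (hf : ∀ w w', KKnuthStep w w' → KKnuth (f w) (f w'))
    {w w' : List ℤ} (h : KKnuth w w') : KKnuth (f w) (f w') := by
  induction h with
  | rel _ _ h => exact hf _ _ h
  | refl _ => exact .refl _
  | symm _ _ _ ih => exact .symm _ _ ih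
  | trans _ _ _ _ _ ih1 ih2 => exact .trans _ _ _ ih1 ih2

lemma append_left (u : List ℤ) {w w' : List ℤ} (h : KKnuth w w') :
    KKnuth (u ++ w) (u ++ w') := by
  refine map_rel (f := (u ++ ·)) (fun w w' h => .rel _ _ ?_) h
  cases h with
  | dup s v a => simpa using KKnuthStep.dup (u ++ s) v a
  | aba s v a b => simpa using KKnuthStep.aba (u ++ s) v a b
  | acb s v a b c h1 h2 => simpa using KKnuthStep.acb (u ++ s) v a b c h1 h2
  | bac s v a b c h1 h2 => simpa using KKnuthStep.bac (u ++ s) v a b c h1 h2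

lemma append_right (u : List ℤ) {w w' : List ℤ} (h : KKnuth w w') :
    KKnuth (w ++ u) (w' ++ u) := by
  refine map_rel (f := (· ++ u)) (fun w w' h => .rel _ _ ?_) h
  cases h with
  | dup s v a => simpa using KKnuthStep.dup s (v ++ u) a
  | aba s v a b => simpa using KKnuthStep.aba s (v ++ u) a b
  | acb s v a b c h1 h2 => simpa using KKnuthStep.acb s (v ++ u) a b c h1 h2
  | bac s v a b c h1 h2 => simpa using KKnuthStep.bac s (v ++ u) a b c h1 h2

lemma cons (x : ℤ) {w w' : List ℤ} (h : KKnuth w w') : KKnuth (x :: w) (x :: w') :=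
  h.append_left [x]

lemma dup (a : ℤ) (v : List ℤ) : KKnuth (a :: a :: v) (a :: v) :=
  .rel _ _ (by simpa using KKnuthStep.dup [] v a)

lemma aba (a b : ℤ) (v : List ℤ) : KKnuth (a :: b :: a :: v) (b :: a :: b :: v) :=
  .rel _ _ (by simpa using KKnuthStep.aba [] v a b)

lemma acb {a b c : ℤ} (h1 : b < a) (h2 : a < c) (v : List ℤ) :
    KKnuth (a :: b :: c :: v) (a :: c :: b :: v) :=
  .rel _ _ (by simpa using KKnuthStep.acb [] v a b c h1 h2)

lemma bac {a b c : ℤ} (h1 : a < c) (h2 : c < b) (v : List ℤ) :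
    KKnuth (a :: b :: c :: v) (b :: a :: c :: v) :=
  .rel _ _ (by simpa using KKnuthStep.bac [] v a b c h1 h2)

lemma reverse_neg {w w' : List ℤ} (h : KKnuth w w') :
    KKnuth (w.map Neg.neg).reverse (w'.map Neg.neg).reverse := by
  refine map_rel (f := fun w => (w.map Neg.neg).reverse) (fun w w' h => ?_) h
  have key : ∀ u v s s' : List ℤ, KKnuth (s.map Neg.neg).reverse (s'.map Neg.neg).reverse →
      KKnuth ((u ++ s ++ v).map Neg.neg).reverse ((u ++ s' ++ v).map Neg.neg).reverse := by
    intro u v s s' h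
    simp only [List.map_append, List.reverse_append]
    exact (h.append_right _).append_left _
  cases h with
  | dup u v a => exact key _ _ _ _ (dup _ _)
  | aba u v a b => exact key _ _ _ _ (aba _ _ _)
  | acb u v a b c h1 h2 => exact key _ _ _ _ (bac (neg_lt_neg h2) (neg_lt_neg h1) _)
  | bac u v a b c h1 h2 => exact key _ _ _ _ (acb (neg_lt_neg h2) (neg_lt_neg h1) _)

/-- A small letter moves to the left past an increasing word. -/
lemma move_left {x y : ℤ} (hxy : x < y) {R : List ℤ} (hR : (y :: R).Pairwise (· < ·))
    (v : List ℤ) : KKnuth (y :: R ++ x :: v) (y :: x :: R ++ v) := by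
  induction R generalizing y with
  | nil => exact rfl' _
  | cons z R ih =>
    have hyz : y < z := (List.pairwise_cons.1 hR).1 z (by simp)
    exact ((ih (hxy.trans hyz) (List.pairwise_cons.1 hR).2).cons y).trans' (acb hxy hyz _).symm'

/-- A large letter moves to the right past an increasing word. -/
lemma move_right {y z : ℤ} (hyz : y < z) {R : List ℤ} (hR : (R ++ [y]).Pairwise (· < ·))
    (v : List ℤ) : KKnuth (z :: R ++ y :: v) (R ++ z :: y :: v) := by
  induction R with
  | nil => exact rfl' _
  | cons x R ih =>
    obtain ⟨h1, h2⟩ := List.pairwise_cons.1 hR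
    refine trans' ?_ ((ih h2).cons x)
    rcases R with _ | ⟨c, R⟩
    · exact (bac (h1 y (by simp)) hyz _).symm'
    · exact (bac (h1 c (by simp)) ((List.pairwise_cons.1 h2).1 y (by simp) |>.trans hyz) _).symm'

lemma erase_upper_aux (q : ℤ) (Y : List (Option ℤ × Option ℤ))
    (hu : (q :: Y.filterMap Prod.snd).Pairwise (· < ·))
    (hY : ∀ l u, (l, u) ∈ Y → ∀ y, l = some y → ∃ x < y, u = some x) :
    KKnuth (q :: Y.filterMap Prod.fst ++ q :: Y.filterMap Prod.snd)
      (q :: Y.filterMap Prod.fst ++ Y.filterMap Prod.snd) := by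
  induction Y using List.reverseRecOn with
  | nil => exact dup _ _
  | append_singleton Y p ih =>
    obtain ⟨l, u⟩ := p
    have hu' : (q :: Y.filterMap Prod.snd).Pairwise (· < ·) := by
      rw [List.filterMap_append, ← List.cons_append] at hu
      exact (List.pairwise_append.1 hu).1
    specialize ih hu' (fun l u h => hY l u (by simp [h]))
    rcases u with _ | x
    · rcases l with _ | y
      · simpa using ih
      · obtain ⟨x, -, hx⟩ := hY (some y) none (by simp) y rfl
        simp at hx
    · rcases l with _ | y
      · simpa using ih.append_right [x]
      · obtain ⟨x', hxy, hx⟩ := hY (some y) (some x) (by simp) y rfl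
        obtain rfl : x = x' := by simpa using hx
        simp only [List.filterMap_append, List.filterMap_cons, List.filterMap_nil] at hu ⊢
        have e1 := (move_right (R := q :: Y.filterMap Prod.snd) hxy hu []).append_left
          (q :: Y.filterMap Prod.fst)
        have e2 := (move_right hxy (List.pairwise_cons.1 hu).2 []).append_left
          (q :: Y.filterMap Prod.fst)
        have e3 := ih.append_right [y, x]
        simp only [List.append_assoc, List.cons_append, List.nil_append] at e1 e2 e3 ⊢
        exact e1.trans' (e3.trans' e2.symm')

/-- Erasing an entry of an upper row which also occurs directly below. -/
lemma erase_upper (q : ℤ) (X Y : List (Option ℤ × Option ℤ))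
    (hl : (X.filterMap Prod.fst ++ q :: Y.filterMap Prod.fst).Pairwise (· < ·))
    (hu : (X.filterMap Prod.snd ++ q :: Y.filterMap Prod.snd).Pairwise (· < ·))
    (hX : ∀ l u, (l, u) ∈ X → ∀ x, u = some x → ∃ y, x ≤ y ∧ l = some y)
    (hY : ∀ l u, (l, u) ∈ Y → ∀ y, l = some y → ∃ x < y, u = some x) :
    KKnuth (X.filterMap Prod.fst ++ q :: Y.filterMap Prod.fst ++
        (X.filterMap Prod.snd ++ q :: Y.filterMap Prod.snd))
      (X.filterMap Prod.fst ++ q :: Y.filterMap Prod.fst ++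
        (X.filterMap Prod.snd ++ Y.filterMap Prod.snd)) := by
  induction X with
  | nil => exact erase_upper_aux q Y hu hY
  | cons p X ih =>
    obtain ⟨l, u⟩ := p
    have hX' : ∀ l u, (l, u) ∈ X → ∀ x, u = some x → ∃ y, x ≤ y ∧ l = some y :=
      fun l u h => hX l u (by simp [h])
    rcases l with _ | a
    · rcases u with _ | x
      · simpa using ih hl hu hX'
      · obtain ⟨y, -, hy⟩ := hX none (some x) (by simp) x rfl
        simp at hy
    · rcases u with _ | x
      · simpa using (ih (List.pairwise_cons.1 hl).2 hu hX').cons a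
      · obtain ⟨a', hxa, ha⟩ := hX (some a) (some x) (by simp) x rfl
        obtain rfl : a = a' := by simpa using ha
        specialize ih (List.pairwise_cons.1 hl).2 (List.pairwise_cons.1 hu).2 hX'
        simp only [List.filterMap_cons] at hl ⊢
        generalize hR : X.filterMap Prod.fst ++ q :: Y.filterMap Prod.fst = R at hl ih
        have hR' : a :: X.filterMap Prod.fst ++ q :: Y.filterMap Prod.fst = a :: R := by
          rw [← hR]; rfl
        rw [hR'] at hl ⊢
        have key : ∃ W, ∀ v, KKnuth (a :: R ++ x :: v) (W ++ (R ++ v)) := by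
          rcases hxa.lt_or_eq with hlt | rfl
          · exact ⟨[a, x], fun v => move_left hlt hl v⟩
          · obtain ⟨r, R', rfl⟩ : ∃ r R', R = r :: R' :=
              List.exists_cons_of_ne_nil (by rw [← hR]; simp)
            obtain ⟨h1, h2⟩ := List.pairwise_cons.1 hl
            exact ⟨[r, x], fun v => ((move_left (h1 r (by simp)) h2 v).cons x).trans'
              (aba x r _)⟩
        obtain ⟨W, hW⟩ := key
        exact (hW _).trans' ((ih.append_left W).trans' (hW _).symm')

/-- Erasing an entry of a lower row which also occurs directly above. -/
lemma erase_lower (q : ℤ) (X Y : List (Option ℤ × Option ℤ))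
    (hl : (X.filterMap Prod.fst ++ q :: Y.filterMap Prod.fst).Pairwise (· < ·))
    (hu : (X.filterMap Prod.snd ++ q :: Y.filterMap Prod.snd).Pairwise (· < ·))
    (hX : ∀ l u, (l, u) ∈ X → ∀ x, u = some x → ∃ y, x < y ∧ l = some y)
    (hY : ∀ l u, (l, u) ∈ Y → ∀ y, l = some y → ∃ x ≤ y, u = some x) :
    KKnuth (X.filterMap Prod.fst ++ q :: Y.filterMap Prod.fst ++
        (X.filterMap Prod.snd ++ q :: Y.filterMap Prod.snd))
      (X.filterMap Prod.fst ++ Y.filterMap Prod.fst ++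
        (X.filterMap Prod.snd ++ q :: Y.filterMap Prod.snd)) := by
  let φ : Option ℤ × Option ℤ → Option ℤ × Option ℤ :=
    fun p => (p.2.map Neg.neg, p.1.map Neg.neg)
  have hf : ∀ Z : List (Option ℤ × Option ℤ), (Z.map φ).reverse.filterMap Prod.fst =
      ((Z.filterMap Prod.snd).map Neg.neg).reverse := by
    intro Z
    rw [List.filterMap_reverse, List.filterMap_map, List.map_filterMap]
    rfl
  have hs : ∀ Z : List (Option ℤ × Option ℤ), (Z.map φ).reverse.filterMap Prod.snd =
      ((Z.filterMap Prod.fst).map Neg.neg).reverse := by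
    intro Z
    rw [List.filterMap_reverse, List.filterMap_map, List.map_filterMap]
    rfl
  have hp : ∀ w : List ℤ, w.Pairwise (· < ·) → (w.map Neg.neg).reverse.Pairwise (· < ·) := by
    intro w hw
    rw [List.pairwise_reverse, List.pairwise_map]
    exact hw.imp fun h => neg_lt_neg h
  have := erase_upper (-q) (Y.map φ).reverse (X.map φ).reverse
    (by simpa [hf] using hp _ hu) (by simpa [hs] using hp _ hl)
    (by
      simp only [List.mem_reverse, List.mem_map, φ, Prod.mk.injEq, Prod.exists]
      rintro _ _ ⟨l, u, hm, rfl, rfl⟩ x hx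
      obtain ⟨y, rfl, rfl⟩ := Option.map_eq_some_iff.1 hx
      obtain ⟨x, hxy, rfl⟩ := hY _ _ hm y rfl
      exact ⟨-x, by simpa using hxy, rfl⟩)
    (by
      simp only [List.mem_reverse, List.mem_map, φ, Prod.mk.injEq, Prod.exists]
      rintro _ _ ⟨l, u, hm, rfl, rfl⟩ x hx
      obtain ⟨y, rfl, rfl⟩ := Option.map_eq_some_iff.1 hx
      obtain ⟨x, hxy, rfl⟩ := hX _ _ hm y rfl
      exact ⟨-x, by simpa using hxy, rfl⟩)
  simpa [hf, hs, Function.comp_def] using this.reverse_neg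

end KKnuth

lemma List.exists_range_eq_append {c n : ℕ} (h : c < n) :
    ∃ l : List ℕ, List.range n = List.range c ++ c :: l ∧ (∀ j ∈ l, c < j) ∧
      (c + 1 < n → ∃ l', l = (c + 1) :: l' ∧ ∀ j ∈ l', c + 1 < j) := by
  obtain ⟨m, rfl⟩ : ∃ m, n = c + (m + 1) := ⟨n - c - 1, by omega⟩
  refine ⟨(List.range m).map (c + 1 + ·), ?_, fun j hj => ?_, fun hm => ?_⟩
  · rw [List.range_add, List.range_succ_eq_map]
    simp [Function.comp_def, add_assoc, add_comm 1]
  · simp only [List.mem_map] at hj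
    omega
  · obtain ⟨m, rfl⟩ : ∃ k, m = k + 1 := ⟨m - 1, by omega⟩
    refine ⟨(List.range m).map (c + 2 + ·), ?_, fun j hj => ?_⟩
    · rw [List.range_succ_eq_map]
      simp only [List.map_cons, List.map_map, Function.comp_def, add_zero, List.cons.injEq,
        true_and]
      exact List.map_congr_left fun a _ => by omega
    · simp only [List.mem_map] at hj
      omega

/-- The values of a partial sequence are strictly increasing. -/
def StrictRow (f : ℕ → Option ℤ) : Prop :=
  ∀ j k x y, j < k → f j = some x → f k = some y → x < y

lemma StrictRow.pairwise {f : ℕ → Option ℤ} (h : StrictRow f) (n : ℕ) :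
    ((List.range n).filterMap f).Pairwise (· < ·) := by
  rw [List.pairwise_filterMap]
  exact List.pairwise_lt_range.imp fun hjk x hx y hy => h _ _ _ _ hjk hx hy

lemma KKnuth.erase_upper_row {L U U' : ℕ → Option ℤ} {n c : ℕ} {q : ℤ} (hc : c < n)
    (hL : StrictRow L) (hU : StrictRow U) (hLc : L c = some q) (hUc : U c = some q)
    (h1 : ∀ j < c, ∀ x, U j = some x → ∃ y, x ≤ y ∧ L j = some y)
    (h2 : ∀ j, c < j → ∀ y, L j = some y → ∃ x < y, U j = some x)
    (hU'c : U' c = none) (hU' : ∀ j ≠ c, U' j = U j) :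
    KKnuth ((List.range n).filterMap L ++ (List.range n).filterMap U)
      ((List.range n).filterMap L ++ (List.range n).filterMap U') := by
  obtain ⟨l, hl, hl', -⟩ := List.exists_range_eq_append hc
  have e1 : (List.range c).filterMap U' = (List.range c).filterMap U :=
    List.filterMap_congr fun j hj => hU' j (by simp at hj; omega)
  have e2 : l.filterMap U' = l.filterMap U :=
    List.filterMap_congr fun j hj => hU' j (by have := hl' j hj; omega)
  have hLs := hL.pairwise n
  have hUs := hU.pairwise n
  simp only [hl, List.filterMap_append, List.filterMap_cons, hLc, hUc, hU'c, e1, e2] at hLs hUs ⊢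
  have key := KKnuth.erase_upper q ((List.range c).map fun j => (L j, U j))
    (l.map fun j => (L j, U j))
    (by simpa [List.filterMap_map, Function.comp_def] using hLs)
    (by simpa [List.filterMap_map, Function.comp_def] using hUs)
    (by
      simp only [List.mem_map, Prod.mk.injEq, List.mem_range]
      rintro _ _ ⟨j, hj, rfl, rfl⟩ x hx
      exact h1 j hj x hx)
    (by
      simp only [List.mem_map, Prod.mk.injEq]
      rintro _ _ ⟨j, hj, rfl, rfl⟩ x hx
      exact h2 j (hl' j hj) x hx)
  simpa [List.filterMap_map, Function.comp_def] using key

lemma KKnuth.erase_lower_row {L U L' : ℕ → Option ℤ} {n c : ℕ} {q : ℤ} (hc : c < n)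
    (hL : StrictRow L) (hU : StrictRow U) (hLc : L c = some q) (hUc : U c = some q)
    (h1 : ∀ j < c, ∀ x, U j = some x → ∃ y, x < y ∧ L j = some y)
    (h2 : ∀ j, c < j → ∀ y, L j = some y → ∃ x ≤ y, U j = some x)
    (hL'c : L' c = none) (hL' : ∀ j ≠ c, L' j = L j) :
    KKnuth ((List.range n).filterMap L ++ (List.range n).filterMap U)
      ((List.range n).filterMap L' ++ (List.range n).filterMap U) := by
  obtain ⟨l, hl, hl', -⟩ := List.exists_range_eq_append hc
  have e1 : (List.range c).filterMap L' = (List.range c).filterMap L :=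
    List.filterMap_congr fun j hj => hL' j (by simp at hj; omega)
  have e2 : l.filterMap L' = l.filterMap L :=
    List.filterMap_congr fun j hj => hL' j (by have := hl' j hj; omega)
  have hLs := hL.pairwise n
  have hUs := hU.pairwise n
  simp only [hl, List.filterMap_append, List.filterMap_cons, hLc, hUc, hL'c, e1, e2] at hLs hUs ⊢
  have key := KKnuth.erase_lower q ((List.range c).map fun j => (L j, U j))
    (l.map fun j => (L j, U j))
    (by simpa [List.filterMap_map, Function.comp_def] using hLs)
    (by simpa [List.filterMap_map, Function.comp_def] using hUs)
    (by
      simp only [List.mem_map, Prod.mk.injEq, List.mem_range]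
      rintro _ _ ⟨j, hj, rfl, rfl⟩ x hx
      exact h1 j hj x hx)
    (by
      simp only [List.mem_map, Prod.mk.injEq]
      rintro _ _ ⟨j, hj, rfl, rfl⟩ x hx
      exact h2 j (hl' j hj) x hx)
  simpa [List.filterMap_map, Function.comp_def] using key

lemma KKnuth.erase_row {f f' : ℕ → Option ℤ} {n c : ℕ} {q : ℤ} (hc : c + 1 < n)
    (h1 : f c = some q) (h2 : f (c + 1) = some q)
    (h : ∀ j, j ≠ c → j ≠ c + 1 → f' j = f j)
    (h' : f' c = none ∧ f' (c + 1) = some q ∨ f' c = some q ∧ f' (c + 1) = none) :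
    KKnuth ((List.range n).filterMap f) ((List.range n).filterMap f') := by
  obtain ⟨l, hl, -, hsucc⟩ := List.exists_range_eq_append (show c < n by omega)
  obtain ⟨l', rfl, hl'⟩ := hsucc hc
  have e1 : (List.range c).filterMap f' = (List.range c).filterMap f :=
    List.filterMap_congr fun j hj => h j (by simp at hj; omega) (by simp at hj; omega)
  have e2 : l'.filterMap f' = l'.filterMap f :=
    List.filterMap_congr fun j hj => h j (by have := hl' j hj; omega)
      (by have := hl' j hj; omega)
  rcases h' with ⟨h3, h4⟩ | ⟨h3, h4⟩ <;>
  · simp only [hl, List.filterMap_append, List.filterMap_cons, h1, h2, h3, h4, e1, e2]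
    exact (KKnuth.dup _ _).append_left _

lemma rowWord_kknuth_of_row {X X' : ℕ × ℕ → Option ℤ} {R C r : ℕ} (hr : r ≤ R)
    (h : ∀ i j, i ≠ r → X (i, j) = X' (i, j))
    (hk : KKnuth ((List.range (C + 1)).filterMap fun j => X (r, j))
      ((List.range (C + 1)).filterMap fun j => X' (r, j))) :
    KKnuth (rowWord X R C) (rowWord X' R C) := by
  obtain ⟨l, hl, hl', -⟩ := List.exists_range_eq_append (show r < R + 1 by omega)
  have e : ∀ m : List ℕ, (∀ i ∈ m, i ≠ r) →
      (m.flatMap fun i => (List.range (C + 1)).filterMap fun j => X (i, j)) =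
      m.flatMap fun i => (List.range (C + 1)).filterMap fun j => X' (i, j) := by
    intro m hm
    rw [List.flatMap_def, List.flatMap_def]
    congr 1
    exact List.map_congr_left fun i hi => List.filterMap_congr fun j _ => h i j (hm i hi)
  simp only [rowWord, hl, List.reverse_append, List.reverse_cons, List.flatMap_append,
    List.flatMap_cons, List.flatMap_nil, List.append_nil]
  rw [e l.reverse (fun i hi => by have := hl' i (by simpa using hi); omega),
    e (List.range r).reverse (fun i hi => by simp at hi; omega)]
  exact (hk.append_left _).append_right _

lemma rowWord_kknuth_of_two_rows {X X' : ℕ × ℕ → Option ℤ} {R C r : ℕ} (hr : r + 1 ≤ R)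
    (h : ∀ i j, i ≠ r → i ≠ r + 1 → X (i, j) = X' (i, j))
    (hk : KKnuth (((List.range (C + 1)).filterMap fun j => X (r + 1, j)) ++
        (List.range (C + 1)).filterMap fun j => X (r, j))
      (((List.range (C + 1)).filterMap fun j => X' (r + 1, j)) ++
        (List.range (C + 1)).filterMap fun j => X' (r, j))) :
    KKnuth (rowWord X R C) (rowWord X' R C) := by
  obtain ⟨l, hl, -, hsucc⟩ := List.exists_range_eq_append (show r < R + 1 by omega)
  obtain ⟨l', rfl, hl'⟩ := hsucc (by omega)
  have e : ∀ m : List ℕ, (∀ i ∈ m, i ≠ r ∧ i ≠ r + 1) →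
      (m.flatMap fun i => (List.range (C + 1)).filterMap fun j => X (i, j)) =
      m.flatMap fun i => (List.range (C + 1)).filterMap fun j => X' (i, j) := by
    intro m hm
    rw [List.flatMap_def, List.flatMap_def]
    congr 1
    exact List.map_congr_left fun i hi =>
      List.filterMap_congr fun j _ => h i j (hm i hi).1 (hm i hi).2
  simp only [rowWord, hl, List.reverse_append, List.reverse_cons, List.flatMap_append,
    List.flatMap_cons, List.flatMap_nil, List.append_nil]
  rw [e l'.reverse (fun i hi => by have := hl' i (by simpa using hi); omega),
    e (List.range r).reverse (fun i hi => by simp at hi; omega)]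
  have := (hk.append_left (l'.reverse.flatMap fun i =>
    (List.range (C + 1)).filterMap fun j => X' (i, j))).append_right
    ((List.range r).reverse.flatMap fun i => (List.range (C + 1)).filterMap fun j => X' (i, j))
  simpa using this

lemma rowWord_congr {X X' : ℕ × ℕ → Option ℤ} {R C : ℕ}
    (h : ∀ i ≤ R, ∀ j ≤ C, X (i, j) = X' (i, j)) : rowWord X R C = rowWord X' R C := by
  simp only [rowWord, List.flatMap_def]
  congr 1
  refine List.map_congr_left fun i hi => List.filterMap_congr fun j hj => ?_
  simp at hi hj
  exact h i (by omega) j (by omega)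

lemma filterMap_range_eq {f : ℕ → Option ℤ} {n m : ℕ} (hnm : n ≤ m)
    (h : ∀ j, n ≤ j → f j = none) :
    (List.range m).filterMap f = (List.range n).filterMap f := by
  induction m, hnm using Nat.le_induction with
  | base => rfl
  | succ m hm ih => simp [List.range_succ, ih, h m hm]

lemma BoundedBy.rowWord_eq_of_le {T : ℕ × ℕ → Option ℤ} {R C R' C' : ℕ} (h : BoundedBy T R C)
    (hR : R ≤ R') (hC : C ≤ C') : rowWord T R' C' = rowWord T R C := by
  have hn : ∀ i j, ¬ (i ≤ R ∧ j ≤ C) → T (i, j) = none := fun i j hij => by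
    by_contra hne
    exact hij (h _ hne)
  induction R', hR using Nat.le_induction with
  | base =>
    simp only [rowWord, List.flatMap_def]
    congr 1
    refine List.map_congr_left fun i _ => filterMap_range_eq (by omega) fun j hj => hn i j ?_
    omega
  | succ m hm ih =>
    rw [rowWord, List.range_succ (n := m + 1), List.reverse_append, List.reverse_singleton,
      List.singleton_append, List.flatMap_cons, ← rowWord, ih,
      filterMap_range_eq (n := 0) (Nat.zero_le _) fun j _ => hn _ j (by omega)]
    simp

lemma BoundedBy.rowWord_eq {T : ℕ × ℕ → Option ℤ} {R C R' C' : ℕ} (h : BoundedBy T R C)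
    (h' : BoundedBy T R' C') : rowWord T R' C' = rowWord T R C := by
  rw [← h.rowWord_eq_of_le (le_max_left R R') (le_max_left C C'),
    ← h'.rowWord_eq_of_le (le_max_right R R') (le_max_right C C')]

lemma Prod.covBy_right (r c : ℕ) : ((r, c) : ℕ × ℕ) ⋖ (r, c + 1) := by
  rw [Prod.mk_covBy_mk_iff]; simp

lemma Prod.covBy_below (r c : ℕ) : ((r, c) : ℕ × ℕ) ⋖ (r + 1, c) := by
  rw [Prod.mk_covBy_mk_iff]; simp

lemma Prod.eq_of_covBy {r c : ℕ} {β : ℕ × ℕ} (h : (r, c) ⋖ β) :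
    β = (r, c + 1) ∨ β = (r + 1, c) := by
  obtain ⟨i, j⟩ := β
  rw [Prod.mk_covBy_mk_iff] at h
  simp only [Nat.covBy_iff_add_one_eq, Prod.mk.injEq] at h ⊢
  omega

lemma Prod.eq_of_covBy' {r c : ℕ} {β : ℕ × ℕ} (h : β ⋖ (r, c)) :
    β.1 = r ∧ β.2 + 1 = c ∨ β.1 + 1 = r ∧ β.2 = c := by
  obtain ⟨i, j⟩ := β
  rw [Prod.mk_covBy_mk_iff] at h
  simp only [Nat.covBy_iff_add_one_eq] at h ⊢
  omega

lemma IsSlideIn.row_lt {S : Set (ℕ × ℕ)} {T T' : ℕ × ℕ → Option ℤ} (h : IsSlideIn S T T')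
    {r j k : ℕ} (hjk : j < k) {u v : ℤ} (hu : T' (r, j) = some u) (hv : T (r, k) = some v) :
    u ≤ v ∧ (u = v → k = j + 1) := by
  obtain ⟨m, rfl⟩ : ∃ m, k = m + 1 := ⟨k - 1, by omega⟩
  have hm : (r, m) ∈ S := h.ordConnected.out (h.mem_right hu) (h.mem_left hv)
    ⟨⟨le_rfl, by simp; omega⟩, ⟨le_rfl, by simp⟩⟩
  obtain ⟨w, hw, hw'⟩ := h.le hm (Prod.covBy_right r m) hv
  rcases (show j ≤ m by omega).lt_or_eq with hlt | rfl
  · have := h.increasing_right (r, j) (r, m) (Prod.mk_lt_mk_iff_right.2 hlt) _ _ hu hw'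
    exact ⟨by omega, by omega⟩
  · obtain rfl : u = w := by simpa [hu] using hw'
    exact ⟨hw, fun _ => rfl⟩

/-- The tableau agreeing with `T'` on the boxes preceding `(r, c)` in reading order by rows from
the top, and with `T` on the others. -/
def mixed (T T' : ℕ × ℕ → Option ℤ) (r c : ℕ) : ℕ × ℕ → Option ℤ := fun p =>
  if p.1 < r ∨ p.1 = r ∧ p.2 < c then T' p else T p

/-- Erasing one box. -/
def eraseBox (X : ℕ × ℕ → Option ℤ) (r c : ℕ) : ℕ × ℕ → Option ℤ := fun p =>
  if p = (r, c) then none else X p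

lemma eraseBox_eq_self {X : ℕ × ℕ → Option ℤ} {r c : ℕ} (h : X (r, c) = none) :
    eraseBox X r c = X := by
  funext p
  by_cases hp : p = (r, c) <;> simp [eraseBox, hp, h]

lemma eraseBox_mixed (T T' : ℕ × ℕ → Option ℤ) (r c : ℕ) :
    eraseBox (mixed T T' r c) r c = eraseBox (mixed T T' r (c + 1)) r c := by
  funext ⟨i, j⟩
  simp only [eraseBox, mixed, Prod.mk.injEq]
  by_cases h : i = r ∧ j = c
  · simp [h]
  · have : (i < r ∨ i = r ∧ j < c) ↔ (i < r ∨ i = r ∧ j < c + 1) := by omega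
    simp [h, this]

lemma IsSlideIn.kknuth_erase_left {S : Set (ℕ × ℕ)} {T T' : ℕ × ℕ → Option ℤ}
    (h : IsSlideIn S T T') {r c R C : ℕ} (hr : r ≤ R) (hc : c ≤ C)
    (hne : T (r, c) ≠ T' (r, c)) :
    KKnuth (rowWord (mixed T T' r c) R C) (rowWord (eraseBox (mixed T T' r c) r c) R C) := by
  rcases hx : T (r, c) with _ | x
  · rw [eraseBox_eq_self (by simpa [mixed] using hx)]
    exact .refl _
  have hrow : ∀ i j, i ≠ r → mixed T T' r c (i, j) = eraseBox (mixed T T' r c) r c (i, j) :=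
    fun i j hi => by simp [eraseBox, hi]
  by_cases hleft : ∃ k, k + 1 = c ∧ T' (r, k) = some x
  · obtain ⟨k, rfl, hk⟩ := hleft
    refine rowWord_kknuth_of_row hr hrow (KKnuth.erase_row (c := k) (q := x) (by omega) ?_ ?_
      (fun j _ hj => ?_) (Or.inr ⟨?_, ?_⟩))
    · simp [mixed, hk]
    · simp [mixed, hx]
    · simp [eraseBox, hj]
    · simp [eraseBox, mixed, hk]
    · simp [eraseBox]
  · obtain ⟨⟨i, j⟩, hcov, hβ⟩ := (h.source hx).resolve_left fun h' => hne (hx.trans h'.symm)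
    have := Prod.eq_of_covBy' hcov
    simp only at this
    rcases this with ⟨rfl, hj⟩ | ⟨rfl, rfl⟩
    · exact absurd ⟨j, hj, hβ⟩ hleft
    have hmem := h.mem_left hx
    refine rowWord_kknuth_of_two_rows (r := i) hr (fun i' j' _ h2 => hrow i' j' h2) ?_
    have e : (fun k => eraseBox (mixed T T' (i + 1) j) (i + 1) j (i, k)) = fun k => T' (i, k) := by
      funext k; simp [eraseBox, mixed]
    have e' : (fun k => mixed T T' (i + 1) j (i, k)) = fun k => T' (i, k) := by
      funext k; simp [mixed]
    rw [e, e']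
    refine KKnuth.erase_lower_row (c := j) (q := x) (by omega) ?_ ?_ ?_ hβ ?_ ?_ ?_ ?_
    · intro k l u v hkl hu hv
      simp only [mixed, lt_irrefl, true_and, false_or] at hu hv
      split_ifs at hu hv with h1 h2 h2
      · exact h.increasing_right _ _ (Prod.mk_lt_mk_iff_right.2 hkl) _ _ hu hv
      · have := h.row_lt hkl hu hv
        refine this.1.lt_of_ne fun huv => hleft ⟨k, by omega, ?_⟩
        have hlj : l = j := by omega
        subst hlj
        rw [hu, huv, ← hv, hx]
      · omega
      · exact h.increasing_left _ _ (Prod.mk_lt_mk_iff_right.2 hkl) _ _ hu hv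
    · intro k l u v hkl hu hv
      exact h.increasing_right _ _ (Prod.mk_lt_mk_iff_right.2 hkl) _ _ hu hv
    · simp [mixed, hx]
    · intro k hk u hu
      have hS : (i + 1, k) ∈ S := h.ordConnected.out (h.mem_right hu) hmem
        ⟨by simp, by simp; omega⟩
      rcases hl : T' (i + 1, k) with _ | l
      · exact absurd (Prod.mk_lt_mk_iff_right.2 hk) (h.maximal hS hl hmem)
      · exact ⟨l, h.increasing_right _ _ (Prod.covBy_below i k).lt _ _ hu hl,
          by simp [mixed, hk, hl]⟩
    · intro k hk l hl
      simp only [mixed, lt_irrefl, true_and, false_or, if_neg hk.not_gt] at hl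
      have hS : (i, k) ∈ S := h.ordConnected.out (h.mem_right hβ) (h.mem_left hl)
        ⟨by simp; omega, by simp⟩
      exact h.le hS (Prod.covBy_below i k) hl
    · simp [eraseBox]
    · intro k hk
      simp [eraseBox, hk]

lemma IsSlideIn.kknuth_erase_right {S : Set (ℕ × ℕ)} {T T' : ℕ × ℕ → Option ℤ}
    (h : IsSlideIn S T T') {r c R C : ℕ} (hr : r ≤ R) (hc : c ≤ C) (hb : BoundedBy T R C)
    (hne : T (r, c) ≠ T' (r, c)) :
    KKnuth (rowWord (mixed T T' r (c + 1)) R C)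
      (rowWord (eraseBox (mixed T T' r (c + 1)) r c) R C) := by
  rcases hx : T' (r, c) with _ | x
  · rw [eraseBox_eq_self (by simpa [mixed] using hx)]
    exact .refl _
  have hrow : ∀ i j, i ≠ r →
      mixed T T' r (c + 1) (i, j) = eraseBox (mixed T T' r (c + 1)) r c (i, j) :=
    fun i j hi => by simp [eraseBox, hi]
  have hS := h.mem_right hx
  by_cases hright : T (r, c + 1) = some x
  · have hcC : c + 1 ≤ C := (hb (r, c + 1) (by simp [hright])).2
    refine rowWord_kknuth_of_row hr hrow (KKnuth.erase_row (c := c) (q := x) (by omega) ?_ ?_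
      (fun j hj _ => ?_) (Or.inl ⟨?_, ?_⟩))
    · simp [mixed, hx]
    · simp [mixed, hright]
    · simp [eraseBox, hj]
    · simp [eraseBox]
    · simp [eraseBox, mixed, hright]
  · obtain ⟨β, hcov, hβ⟩ := (h.target hx).resolve_left fun h' => hne (h'.trans hx.symm)
    rcases Prod.eq_of_covBy hcov with rfl | rfl
    · exact absurd hβ hright
    have hrR : r + 1 ≤ R := (hb (r + 1, c) (by simp [hβ])).1
    refine rowWord_kknuth_of_two_rows (r := r) hrR (fun i' j' h1 _ => hrow i' j' h1) ?_
    have e : (fun k => eraseBox (mixed T T' r (c + 1)) r c (r + 1, k)) =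
        fun k => T (r + 1, k) := by
      funext k; simp [eraseBox, mixed]
    have e' : (fun k => mixed T T' r (c + 1) (r + 1, k)) = fun k => T (r + 1, k) := by
      funext k; simp [mixed]
    rw [e, e']
    refine KKnuth.erase_upper_row (c := c) (q := x) (by omega) ?_ ?_ hβ ?_ ?_ ?_ ?_ ?_
    · intro k l u v hkl hu hv
      exact h.increasing_left _ _ (Prod.mk_lt_mk_iff_right.2 hkl) _ _ hu hv
    · intro k l u v hkl hu hv
      simp only [mixed, lt_irrefl, true_and, false_or] at hu hv
      split_ifs at hu hv with h1 h2 h2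
      · exact h.increasing_right _ _ (Prod.mk_lt_mk_iff_right.2 hkl) _ _ hu hv
      · have := h.row_lt hkl hu hv
        refine this.1.lt_of_ne fun huv => hright ?_
        have hlk := this.2 huv
        obtain rfl : k = c := by omega
        subst hlk
        rw [hv, ← huv, ← hu, hx]
      · omega
      · exact h.increasing_left _ _ (Prod.mk_lt_mk_iff_right.2 hkl) _ _ hu hv
    · simp [mixed, hx]
    · intro k hk u hu
      have hu : T' (r, k) = some u := by
        simpa only [mixed, lt_irrefl, true_and, false_or, if_pos (hk.trans (Nat.lt_succ_self c))]
          using hu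
      have hS' : (r + 1, k) ∈ S := h.ordConnected.out (h.mem_right hu) (h.mem_left hβ)
        ⟨by simp, by simp; omega⟩
      rcases hl : T (r + 1, k) with _ | l
      · exact absurd (Prod.covBy_below r k).lt (h.minimal hS' hl (h.mem_right hu))
      · obtain ⟨w, hw, hw'⟩ := h.le (h.mem_right hu) (Prod.covBy_below r k) hl
        obtain rfl : u = w := by simpa [hu] using hw'
        exact ⟨l, hw, rfl⟩
    · intro k hk l hl
      have hS' : (r, k) ∈ S := h.ordConnected.out hS (h.mem_left hl)
        ⟨by simp; omega, by simp⟩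
      rcases hu : T (r, k) with _ | u
      · exact absurd (Prod.mk_lt_mk_iff_right.2 hk) (h.minimal hS' hu hS)
      · refine ⟨u, h.increasing_left _ _ (Prod.covBy_below r k).lt _ _ hu hl, ?_⟩
        simp [mixed, hu, show ¬ k < c + 1 by omega]
    · simp [eraseBox]
    · intro k hk
      simp [eraseBox, hk]

lemma IsSlideIn.kknuth_mixed_succ {S : Set (ℕ × ℕ)} {T T' : ℕ × ℕ → Option ℤ}
    (h : IsSlideIn S T T') {r c R C : ℕ} (hr : r ≤ R) (hc : c ≤ C) (hb : BoundedBy T R C) :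
    KKnuth (rowWord (mixed T T' r c) R C) (rowWord (mixed T T' r (c + 1)) R C) := by
  by_cases hne : T (r, c) = T' (r, c)
  · have : mixed T T' r c = mixed T T' r (c + 1) := by
      funext ⟨i, j⟩
      by_cases hij : i = r ∧ j = c
      · obtain ⟨rfl, rfl⟩ := hij
        simp [mixed, hne]
      · have : (i < r ∨ i = r ∧ j < c) ↔ (i < r ∨ i = r ∧ j < c + 1) := by omega
        simp [mixed, this]
    rw [this]
    exact .refl _
  · have := h.kknuth_erase_left hr hc hne
    rw [eraseBox_mixed] at this
    exact this.trans' (h.kknuth_erase_right hr hc hb hne).symm'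

/-- A slide does not change the K-Knuth class of the row word. -/
lemma IsSlideIn.kknuth {S : Set (ℕ × ℕ)} {T T' : ℕ × ℕ → Option ℤ} (h : IsSlideIn S T T')
    {R C : ℕ} (hb : BoundedBy T R C) : KKnuth (rowWord T R C) (rowWord T' R C) := by
  have hcol : ∀ r ≤ R, ∀ c ≤ C + 1,
      KKnuth (rowWord (mixed T T' r 0) R C) (rowWord (mixed T T' r c) R C) := by
    intro r hr c hc
    induction c with
    | zero => exact .refl _
    | succ c ih => exact (ih (by omega)).trans' (h.kknuth_mixed_succ hr (by omega) hb)
  have hrows : ∀ r ≤ R + 1,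
      KKnuth (rowWord (mixed T T' 0 0) R C) (rowWord (mixed T T' r 0) R C) := by
    intro r hr
    induction r with
    | zero => exact .refl _
    | succ r ih =>
      refine (ih (by omega)).trans' ((hcol r (by omega) (C + 1) le_rfl).trans' ?_)
      rw [rowWord_congr (X' := mixed T T' (r + 1) 0)]
      · exact .refl _
      · intro i _ j _
        have : (i < r ∨ i = r ∧ j < C + 1) ↔ (i < r + 1 ∨ i = r + 1 ∧ j < 0) := by omega
        simp only [mixed, this]
  have h0 : mixed T T' 0 0 = T := by funext p; simp [mixed]
  have h1 : rowWord (mixed T T' (R + 1) 0) R C = rowWord T' R C :=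
    rowWord_congr fun i hi j _ => by simp [mixed, Nat.lt_succ_of_le hi]
  simpa [h0, h1] using hrows (R + 1) le_rfl

lemma exists_boundedBy {T : ℕ × ℕ → Option ℤ} (hT : (shapeOf T).Finite) :
    ∃ N, ∀ R C, N ≤ R → N ≤ C → BoundedBy T R C := by
  obtain ⟨⟨a, b⟩, hab⟩ := hT.bddAbove
  refine ⟨max a b, fun R C hR hC p hp => ?_⟩
  have := hab hp
  rw [Prod.le_def] at this
  simp at this hR hC
  omega

lemma SlideEquiv.kknuth {T T' : ℕ × ℕ → Option ℤ} (h : SlideEquiv T T')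
    (hT : IncreasingSkewTableau T) {R C R' C' : ℕ} (hb : BoundedBy T R C)
    (hb' : BoundedBy T' R' C') : KKnuth (rowWord T R C) (rowWord T' R' C') := by
  have key : ∃ N, ∀ R C, N ≤ R → N ≤ C → KKnuth (rowWord T R C) (rowWord T' R C) := by
    clear hb hb'
    induction h with
    | rel T T' h =>
      obtain ⟨N, hN⟩ := exists_boundedBy hT.1.finite
      obtain ⟨S, h⟩ := h
      exact ⟨N, fun R C hR hC => h.kknuth (hN R C hR hC)⟩
    | refl T => exact ⟨0, fun R C _ _ => .refl _⟩
    | symm T T' h ih =>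
      obtain ⟨N, hN⟩ := ih ((SlideEquiv.skew_iff h).2 hT)
      exact ⟨N, fun R C hR hC => (hN R C hR hC).symm'⟩
    | trans T T' T'' h1 h2 ih1 ih2 =>
      obtain ⟨N, hN⟩ := ih1 hT
      obtain ⟨N', hN'⟩ := ih2 ((SlideEquiv.skew_iff h1).1 hT)
      refine ⟨max N N', fun R C hR hC => (hN R C ?_ ?_).trans' (hN' R C ?_ ?_)⟩ <;> omega
  obtain ⟨N, hN⟩ := key
  have := hN (max N (max R R')) (max N (max C C')) (by simp) (by simp)
  rwa [hb.rowWord_eq_of_le (by simp) (by simp), hb'.rowWord_eq_of_le (by simp) (by simp)] at this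

/-- Reflection of a tableau in the diagonal. -/
def transpose (T : ℕ × ℕ → Option ℤ) : ℕ × ℕ → Option ℤ := fun p => T p.swap

lemma IsSlideIn.transpose {S : Set (ℕ × ℕ)} {T T' : ℕ × ℕ → Option ℤ} (h : IsSlideIn S T T') :
    IsSlideIn (Prod.swap ⁻¹' S) (transpose T) (transpose T') where
  finite := h.finite.preimage Prod.swap_injective.injOn
  ordConnected := ⟨fun _ hα _ hβ _ hγ => h.ordConnected.out hα hβ
    ⟨Prod.swap_le_swap.2 hγ.1, Prod.swap_le_swap.2 hγ.2⟩⟩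
  mem_left := fun hx => h.mem_left hx
  mem_right := fun hx => h.mem_right hx
  minimal := fun hα hn hβ hlt => h.minimal hα hn hβ (Prod.swap_lt_swap.2 hlt)
  maximal := fun hα hn hβ hlt => h.maximal hα hn hβ (Prod.swap_lt_swap.2 hlt)
  increasing_left := fun _ _ hlt _ _ hx hy =>
    h.increasing_left _ _ (Prod.swap_lt_swap.2 hlt) _ _ hx hy
  increasing_right := fun _ _ hlt _ _ hx hy =>
    h.increasing_right _ _ (Prod.swap_lt_swap.2 hlt) _ _ hx hy
  source := by
    intro α x hx
    rcases h.source hx with h1 | ⟨β, hc, h1⟩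
    · exact Or.inl h1
    · exact Or.inr ⟨β.swap, by rwa [← Prod.swap_covBy_swap, Prod.swap_swap], h1⟩
  target := by
    intro α x hx
    rcases h.target hx with h1 | ⟨β, hc, h1⟩
    · exact Or.inl h1
    · exact Or.inr ⟨β.swap, by rwa [← Prod.swap_covBy_swap, Prod.swap_swap], h1⟩
  le := fun hα hc hv => h.le hα (Prod.swap_covBy_swap.2 hc) hv

lemma IncreasingSkewTableau.ordConnected {T : ℕ × ℕ → Option ℤ} (h : IncreasingSkewTableau T)
    {i j i' j' k l : ℕ} (h1 : T (i, j) ≠ none) (h2 : T (i', j') ≠ none)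
    (hik : i ≤ k) (hjl : j ≤ l) (hki : k ≤ i') (hlj : l ≤ j') : T (k, l) ≠ none :=
  h.1.ordConnected.out h1 h2 ⟨⟨hik, hjl⟩, ⟨hki, hlj⟩⟩

lemma IncreasingSkewTableau.transpose {T : ℕ × ℕ → Option ℤ} (h : IncreasingSkewTableau T) :
    IncreasingSkewTableau (transpose T) := by
  refine ⟨hasSkewShape_of_ordConnected (h.1.finite.preimage Prod.swap_injective.injOn)
    ⟨fun α hα β hβ γ hγ => h.1.ordConnected.out (x := α.swap) (y := β.swap) hα hβ
      ⟨Prod.swap_le_swap.2 hγ.1, Prod.swap_le_swap.2 hγ.2⟩⟩, fun _ _ hlt _ _ hx hy =>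
    h.2 _ _ (Prod.swap_lt_swap.2 hlt) _ _ hx hy⟩

lemma SlideEquiv.map {F : (ℕ × ℕ → Option ℤ) → (ℕ × ℕ → Option ℤ)}
    (hF : ∀ T T', Slide T T' → SlideEquiv (F T) (F T')) {T T' : ℕ × ℕ → Option ℤ}
    (h : SlideEquiv T T') : SlideEquiv (F T) (F T') := by
  induction h with
  | rel _ _ h => exact hF _ _ h
  | refl _ => exact .refl _
  | symm _ _ _ ih => exact .symm _ _ ih
  | trans _ _ _ _ _ ih1 ih2 => exact .trans _ _ _ ih1 ih2

lemma SlideEquiv.transpose {T T' : ℕ × ℕ → Option ℤ} (h : SlideEquiv T T') :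
    SlideEquiv (transpose T) (transpose T') :=
  h.map fun _ _ ⟨_, h⟩ => .rel _ _ ⟨_, h.transpose⟩

/-- Shift each row `i` by `f i` to the right. -/
def rowShift (f : ℕ → ℕ) (T : ℕ × ℕ → Option ℤ) : ℕ × ℕ → Option ℤ := fun p =>
  if f p.1 ≤ p.2 then T (p.1, p.2 - f p.1) else none

lemma rowShift_eq_some {f : ℕ → ℕ} {T : ℕ × ℕ → Option ℤ} {i j : ℕ} {x : ℤ} :
    rowShift f T (i, j) = some x ↔ ∃ k, j = k + f i ∧ T (i, k) = some x := by
  simp only [rowShift]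
  split_ifs with h
  · refine ⟨fun h' => ⟨j - f i, by omega, h'⟩, ?_⟩
    rintro ⟨k, rfl, hk⟩
    simpa using hk
  · simp only [false_iff, not_exists, not_and]
    omega

lemma rowShift_ne_none {f : ℕ → ℕ} {T : ℕ × ℕ → Option ℤ} {i j : ℕ} :
    rowShift f T (i, j) ≠ none ↔ ∃ k, j = k + f i ∧ T (i, k) ≠ none := by
  simp only [Option.ne_none_iff_exists', rowShift_eq_some]
  grind

lemma rowShift_rowShift (f g : ℕ → ℕ) (T : ℕ × ℕ → Option ℤ) :
    rowShift f (rowShift g T) = rowShift (f + g) T := by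
  funext ⟨i, j⟩
  refine Option.ext fun x => ?_
  simp only [rowShift_eq_some, Pi.add_apply]
  constructor
  · rintro ⟨k, rfl, l, rfl, h⟩
    exact ⟨l, by omega, h⟩
  · rintro ⟨k, rfl, h⟩
    exact ⟨k + g i, by omega, k, rfl, h⟩

lemma rowShift_zero (T : ℕ × ℕ → Option ℤ) : rowShift 0 T = T := by
  funext ⟨i, j⟩
  simp [rowShift]

/-- Shifting a row by one step when there are no boxes above it nearby. -/
lemma slide_rowShift_single {U : ℕ × ℕ → Option ℤ} (hU : IncreasingSkewTableau U) (r : ℕ)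
    (hclear : ∀ i j k, i < r → U (i, j) ≠ none → U (r, k) ≠ none → k + 1 < j) :
    Slide (rowShift (Pi.single r 1) U) U := by
  set V := rowShift (Pi.single r 1) U with hV
  have hVr : ∀ j x, V (r, j) = some x ↔ ∃ k, j = k + 1 ∧ U (r, k) = some x := fun j x => by
    simp [hV, rowShift_eq_some]
  have hVi : ∀ i j, i ≠ r → V (i, j) = U (i, j) := fun i j hi => by
    simp [hV, rowShift, hi]
  have hVr' : ∀ j, V (r, j) ≠ none ↔ ∃ k, j = k + 1 ∧ U (r, k) ≠ none := fun j => by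
    simp [hV, rowShift_ne_none]
  have hS : ∀ i j, (i, j) ∈ shapeOf U ∪ shapeOf V ↔
      U (i, j) ≠ none ∨ i = r ∧ ∃ k, j = k + 1 ∧ U (r, k) ≠ none := by
    intro i j
    by_cases hi : i = r
    · subst hi
      simp only [Set.mem_union, ← hVr']
      simp [shapeOf]
    · simp [shapeOf, hVi i j hi, hi]
  refine ⟨shapeOf U ∪ shapeOf V, ?_, ?_, ?_, ?_, ?_, ?_, ?_, ?_, ?_, ?_, ?_⟩
  · refine (hU.1.finite.union (hU.1.finite.image fun p => (p.1, p.2 + 1))).subset ?_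
    rintro ⟨i, j⟩ hp
    rcases (hS i j).1 hp with h | ⟨rfl, k, rfl, h⟩
    · exact Or.inl h
    · exact Or.inr ⟨(i, k), h, rfl⟩
  · refine ⟨?_⟩
    rintro ⟨i, j⟩ hα ⟨i', j'⟩ hβ ⟨k, l⟩ ⟨⟨h1, h2⟩, ⟨h3, h4⟩⟩
    simp only at h1 h2 h3 h4
    rw [hS] at hα hβ ⊢
    rcases hβ with hβ | ⟨rfl, m', rfl, hβ⟩
    · rcases hα with hα | ⟨rfl, m, rfl, hα⟩
      · exact Or.inl (hU.ordConnected hα hβ h1 h2 h3 h4)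
      · exact Or.inl (hU.ordConnected hα hβ h1 (by omega) h3 h4)
    · rcases hα with hα | ⟨rfl, m, rfl, hα⟩
      · by_cases hi : i < i'
        · have := hclear _ _ _ hi hα hβ
          omega
        · obtain rfl : i = i' := by omega
          obtain rfl : i = k := by omega
          by_cases hl : l = m' + 1
          · exact Or.inr ⟨rfl, m', hl, hβ⟩
          · exact Or.inl (hU.ordConnected hα hβ h1 h2 h3 (by omega))
      · obtain rfl : i = k := by omega
        exact Or.inr ⟨rfl, l - 1, by omega,
          hU.ordConnected hα hβ le_rfl (by omega) le_rfl (by omega)⟩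
  · intro α x hx
    exact Or.inr (by simp [shapeOf, hx])
  · intro α x hx
    exact Or.inl (by simp [shapeOf, hx])
  · rintro ⟨i, j⟩ ⟨i', j'⟩ hα hn hβ hlt
    obtain ⟨⟨h1, h2⟩, h3⟩ := Prod.mk_lt_mk.1 hlt |>.elim
      (fun h => (⟨⟨h.1.le, h.2⟩, Or.inl h.1⟩ : (i' ≤ i ∧ j' ≤ j) ∧ (i' < i ∨ j' < j)))
      (fun h => ⟨⟨h.1, h.2.le⟩, Or.inr h.2⟩)
    have hi : i = r := by
      by_contra hi
      rw [hVi _ _ hi] at hn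
      rcases (hS i j).1 hα with h | h
      · exact h hn
      · exact hi h.1
    subst hi
    have hn' : ∀ k, j = k + 1 → U (i, k) = none := fun k hk => by
      by_contra hne
      exact (hVr' j).2 ⟨k, hk, hne⟩ hn
    have hα' : U (i, j) ≠ none := by
      rcases (hS i j).1 hα with h | ⟨-, k, hk, h⟩
      · exact h
      · exact absurd (hn' k hk) h
    rcases (hS i' j').1 hβ with h | ⟨rfl, k, rfl, h⟩
    · by_cases hi : i' < i
      · have := hclear _ _ _ hi h hα'
        omega
      · obtain rfl : i' = i := by omega
        exact hU.ordConnected (k := i') (l := j - 1) h hα' (by omega) (by omega) (by omega)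
          (by omega) (hn' (j - 1) (by omega))
    · exact hU.ordConnected (k := i') (l := j - 1) h hα' (by omega) (by omega) (by omega)
          (by omega) (hn' (j - 1) (by omega))
  · rintro ⟨i, j⟩ ⟨i', j'⟩ hα hn hβ hlt
    obtain ⟨h1, h2⟩ := Prod.mk_le_mk.1 hlt.le
    rcases (hS i j).1 hα with h | ⟨rfl, k, rfl, h⟩
    · exact h hn
    rcases (hS i' j').1 hβ with h' | ⟨rfl, k', rfl, h'⟩
    · exact hU.ordConnected h h' (by omega) (by omega) h1 h2 hn
    · refine hU.ordConnected (k := i') (l := k + 1) h h' le_rfl (by omega) le_rfl ?_ hn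
      by_contra hk
      obtain rfl : k = k' := by omega
      exact lt_irrefl _ hlt
  · rintro ⟨i, j⟩ ⟨i', j'⟩ hlt x y hx hy
    obtain ⟨h1, h2⟩ := Prod.mk_le_mk.1 hlt.le
    by_cases hi : i = r <;> by_cases hi' : i' = r
    · subst hi hi'
      obtain ⟨k, rfl, hk⟩ := (hVr _ _).1 hx
      obtain ⟨k', rfl, hk'⟩ := (hVr _ _).1 hy
      refine hU.2 _ _ ?_ _ _ hk hk'
      have := Prod.mk_lt_mk_iff_right.1 hlt
      exact Prod.mk_lt_mk_iff_right.2 (by omega)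
    · subst hi
      obtain ⟨k, rfl, hk⟩ := (hVr _ _).1 hx
      rw [hVi _ _ hi'] at hy
      exact hU.2 _ _ (Prod.mk_lt_mk.2 (Or.inl ⟨by omega, by omega⟩)) _ _ hk hy
    · subst hi'
      obtain ⟨k, rfl, hk⟩ := (hVr _ _).1 hy
      rw [hVi _ _ hi] at hx
      have := hclear i j k (by omega) (by simp [hx]) (by simp [hk])
      omega
    · rw [hVi _ _ hi] at hx
      rw [hVi _ _ hi'] at hy
      exact hU.2 _ _ hlt _ _ hx hy
  · exact hU.2
  · rintro ⟨i, j⟩ x hx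
    by_cases hi : i = r
    · subst hi
      obtain ⟨k, rfl, hk⟩ := (hVr _ _).1 hx
      exact Or.inr ⟨(i, k), Prod.covBy_right _ _, hk⟩
    · rw [hVi _ _ hi] at hx
      exact Or.inl hx
  · rintro ⟨i, j⟩ x hx
    by_cases hi : i = r
    · subst hi
      exact Or.inr ⟨(i, j + 1), Prod.covBy_right _ _, (hVr _ _).2 ⟨j, rfl, hx⟩⟩
    · exact Or.inl (by rwa [hVi _ _ hi])
  · rintro ⟨i, j⟩ β v hα hc hv
    rcases Prod.eq_of_covBy hc with rfl | rfl
    · by_cases hi : i = r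
      · subst hi
        obtain ⟨k, hk, hk'⟩ := (hVr _ _).1 hv
        obtain rfl : j = k := by omega
        exact ⟨v, le_rfl, hk'⟩
      · rw [hVi _ _ hi] at hv
        have hne : U (i, j) ≠ none := ((hS i j).1 hα).resolve_right fun h => hi h.1
        obtain ⟨u, hu⟩ := Option.ne_none_iff_exists'.1 hne
        exact ⟨u, (hU.2 _ _ hc.lt _ _ hu hv).le, hu⟩
    · by_cases hi : i + 1 = r
      · subst hi
        obtain ⟨k, rfl, hk⟩ := (hVr _ _).1 hv
        have hne : U (i, k + 1) ≠ none := ((hS i _).1 hα).resolve_right fun h => by omega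
        have := hclear i _ k (by omega) hne (by simp [hk])
        omega
      · rw [hVi _ _ hi] at hv
        have hne : U (i, j) ≠ none := by
          rcases (hS i j).1 hα with h | ⟨rfl, k, rfl, h⟩
          · exact h
          · exact hU.ordConnected h (show U (i + 1, k + 1) ≠ none by simp [hv]) le_rfl
              (by omega) (by omega) le_rfl
        obtain ⟨u, hu⟩ := Option.ne_none_iff_exists'.1 hne
        exact ⟨u, (hU.2 _ _ hc.lt _ _ hu hv).le, hu⟩

/-- Shifting rows so that every row moved stays well to the left of the rows above it. -/
lemma slideEquiv_rowShift {T : ℕ × ℕ → Option ℤ} (hT : IncreasingSkewTableau T) (f : ℕ → ℕ)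
    (hf : ∀ r' r c' c, r' < r → T (r', c') ≠ none → T (r, c) ≠ none → f r ≠ 0 →
      c + f r + 1 < c' + f r') : SlideEquiv T (rowShift f T) := by
  have hrows : ∀ s, SlideEquiv T (rowShift (fun i => if i < s then f i else 0) T) := by
    intro s
    induction s with
    | zero => simpa using (rowShift_zero T).symm ▸ .refl T
    | succ s ih =>
      have hm : ∀ m ≤ f s, SlideEquiv T
          (rowShift (fun i => if i < s then f i else if i = s then m else 0) T) := by
        intro m hm
        induction m with
        | zero => simpa using ih
        | succ m ihm =>
          specialize ihm (by omega)
          refine ihm.trans _ _ _ (.symm _ _ (.rel _ _ ?_))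
          convert slide_rowShift_single (ihm.skew_iff.1 hT) s ?_ using 1
          · rw [rowShift_rowShift]
            congr 1
            funext i
            by_cases hi : i = s
            · subst hi
              simp [add_comm]
            · simp [hi]
          · intro i j k hi h1 h2
            rw [rowShift_ne_none] at h1 h2
            obtain ⟨j, rfl, h1⟩ := h1
            obtain ⟨k, rfl, h2⟩ := h2
            have := hf _ _ _ _ hi h1 h2 (by omega)
            simp only [lt_irrefl, if_false, if_true, hi]
            omega
      convert hm (f s) le_rfl using 3 with i
      by_cases hi : i = s
      · simp [hi]
      · have : i < s + 1 ↔ i < s := by omega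
        simp [hi, this]
  obtain ⟨N, hN⟩ := exists_boundedBy hT.1.finite
  convert hrows (N + 1) using 1
  funext ⟨i, j⟩
  by_cases hi : i < N + 1
  · simp [rowShift, hi]
  · have hn : ∀ k, T (i, k) = none := fun k => by
      by_contra hne
      have := (hN N (N + k) le_rfl (by omega) (i, k) hne).1
      simp at this
      omega
    simp [rowShift, hn]

/-- Add a box with entry `x` in row `R` of a new leftmost column. -/
def prepend (R : ℕ) (x : ℤ) (U : ℕ × ℕ → Option ℤ) : ℕ × ℕ → Option ℤ := fun p =>
  if p = (R, 0) then some x else rowShift (fun _ => 1) U p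

lemma prepend_eq_some {R : ℕ} {x y : ℤ} {U : ℕ × ℕ → Option ℤ} {i j : ℕ} :
    prepend R x U (i, j) = some y ↔
      (i = R ∧ j = 0 ∧ x = y) ∨ ∃ k, j = k + 1 ∧ U (i, k) = some y := by
  by_cases h : (i, j) = (R, 0)
  · obtain ⟨rfl, rfl⟩ := Prod.mk.inj h
    simp [prepend]
  · simp only [prepend, h, if_false, rowShift_eq_some]
    simp only [Prod.mk.injEq] at h
    constructor
    · exact Or.inr
    · rintro (⟨h1, h2, -⟩ | h1)
      · exact absurd ⟨h1, h2⟩ h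
      · exact h1

lemma prepend_zero {R : ℕ} {x : ℤ} {U : ℕ × ℕ → Option ℤ} {i : ℕ} (hi : i ≠ R) :
    prepend R x U (i, 0) = none := by
  simp [prepend, hi, rowShift]

lemma prepend_succ {R : ℕ} {x : ℤ} {U : ℕ × ℕ → Option ℤ} {i j : ℕ} :
    prepend R x U (i, j + 1) = U (i, j) := by
  simp [prepend, rowShift]

lemma IsSlideIn.refl {T : ℕ × ℕ → Option ℤ} (h : IncreasingSkewTableau T) :
    IsSlideIn (shapeOf T) T T where
  finite := h.1.finite
  ordConnected := h.1.ordConnected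
  mem_left := fun hx => mem_shapeOf_iff.2 ⟨_, hx⟩
  mem_right := fun hx => mem_shapeOf_iff.2 ⟨_, hx⟩
  minimal := fun hα hn _ _ => hα hn
  maximal := fun hα hn _ _ => hα hn
  increasing_left := h.2
  increasing_right := h.2
  source := Or.inl
  target := Or.inl
  le := by
    intro α β v hα hc hv
    obtain ⟨u, hu⟩ := mem_shapeOf_iff.1 hα
    exact ⟨u, (h.2 _ _ hc.lt _ _ hu hv).le, hu⟩

lemma increasing_prepend {R : ℕ} {x : ℤ} {U : ℕ × ℕ → Option ℤ} (hU : Increasing U)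
    (hR : ∀ i j, U (i, j) ≠ none → i < R) : Increasing (prepend R x U) := by
  rintro ⟨i, j⟩ ⟨i', j'⟩ hlt y z hy hz
  obtain ⟨h1, h2⟩ := Prod.mk_le_mk.1 hlt.le
  rw [prepend_eq_some] at hy hz
  rcases hy with ⟨rfl, rfl, rfl⟩ | ⟨k, rfl, hk⟩ <;> rcases hz with ⟨rfl, rfl, rfl⟩ | ⟨k', rfl, hk'⟩
  · exact absurd hlt (lt_irrefl _)
  · have := hR _ _ (by simp [hk'] : U (i', k') ≠ none)
    omega
  · omega
  · refine hU _ _ ?_ _ _ hk hk'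
    rw [Prod.mk_lt_mk] at hlt ⊢
    omega

lemma IsSlideIn.prepend {S : Set (ℕ × ℕ)} {T T' : ℕ × ℕ → Option ℤ} (h : IsSlideIn S T T')
    {R : ℕ} (hR : ∀ p ∈ S, p.1 < R) (x : ℤ) :
    IsSlideIn {p | p = (R, 0) ∨ ∃ i j, p = (i, j + 1) ∧ (i, j) ∈ S} (prepend R x T)
      (prepend R x T') := by
  have hs : ∀ {i j}, ((i, j + 1) : ℕ × ℕ) ∈
      {p : ℕ × ℕ | p = (R, 0) ∨ ∃ i j, p = (i, j + 1) ∧ (i, j) ∈ S} ↔ (i, j) ∈ S := by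
    intro i j
    simp
  have h0 : ∀ {i}, ((i, 0) : ℕ × ℕ) ∈
      {p : ℕ × ℕ | p = (R, 0) ∨ ∃ i j, p = (i, j + 1) ∧ (i, j) ∈ S} ↔ i = R := by
    intro i
    simp
  refine ⟨?_, ⟨?_⟩, ?_, ?_, ?_, ?_, ?_, ?_, ?_, ?_, ?_⟩
  · refine ((Set.finite_singleton (R, 0)).union (h.finite.image fun p => (p.1, p.2 + 1))).subset ?_
    rintro p (hp | ⟨i, j, rfl, hp⟩)
    · exact Or.inl hp
    · exact Or.inr ⟨(i, j), hp, rfl⟩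
  · rintro ⟨i, j⟩ hα ⟨i', j'⟩ hβ ⟨k, l⟩ ⟨⟨h1, h2⟩, ⟨h3, h4⟩⟩
    simp only at h1 h2 h3 h4
    rcases j with _ | j <;> rcases j' with _ | j' <;> rcases l with _ | l <;>
      simp only [hs, h0] at hα hβ ⊢ <;> try omega
    · have := hR _ hβ
      simp only at this
      omega
    · have := hR _ hβ
      simp only at this
      omega
    · exact h.ordConnected.out hα hβ ⟨⟨h1, by simpa using h2⟩, ⟨h3, by simpa using h4⟩⟩
  · rintro ⟨i, j⟩ y hy
    rcases prepend_eq_some.1 hy with ⟨rfl, rfl, -⟩ | ⟨k, rfl, hk⟩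
    · exact h0.2 rfl
    · exact hs.2 (h.mem_left hk)
  · rintro ⟨i, j⟩ y hy
    rcases prepend_eq_some.1 hy with ⟨rfl, rfl, -⟩ | ⟨k, rfl, hk⟩
    · exact h0.2 rfl
    · exact hs.2 (h.mem_right hk)
  · rintro ⟨i, j⟩ ⟨i', j'⟩ hα hn hβ hlt
    rcases j with _ | j
    · obtain rfl := h0.1 hα
      simp [_root_.prepend] at hn
    rw [hs] at hα
    rw [prepend_succ] at hn
    rcases j' with _ | j'
    · have := hR _ hα
      rw [h0] at hβ
      have := (Prod.mk_le_mk.1 hlt.le).1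
      simp only at *
      omega
    · rw [hs] at hβ
      refine h.minimal hα hn hβ ?_
      rw [Prod.mk_lt_mk] at hlt ⊢
      omega
  · rintro ⟨i, j⟩ ⟨i', j'⟩ hα hn hβ hlt
    rcases j with _ | j
    · obtain rfl := h0.1 hα
      simp [_root_.prepend] at hn
    rw [hs] at hα
    rw [prepend_succ] at hn
    rcases j' with _ | j'
    · have := (Prod.mk_le_mk.1 hlt.le).2
      omega
    · rw [hs] at hβ
      refine h.maximal hα hn hβ ?_
      rw [Prod.mk_lt_mk] at hlt ⊢
      omega
  · refine increasing_prepend h.increasing_left fun i j hij => ?_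
    obtain ⟨y, hy⟩ := Option.ne_none_iff_exists'.1 hij
    exact hR _ (h.mem_left hy)
  · refine increasing_prepend h.increasing_right fun i j hij => ?_
    obtain ⟨y, hy⟩ := Option.ne_none_iff_exists'.1 hij
    exact hR _ (h.mem_right hy)
  · rintro ⟨i, j⟩ y hy
    rcases prepend_eq_some.1 hy with ⟨rfl, rfl, rfl⟩ | ⟨k, rfl, hk⟩
    · exact Or.inl (by simp [_root_.prepend])
    · rw [prepend_succ]
      rcases h.source hk with h1 | ⟨⟨i', j'⟩, hc, h1⟩
      · exact Or.inl h1
      · refine Or.inr ⟨(i', j' + 1), ?_, by rwa [prepend_succ]⟩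
        rw [Prod.mk_covBy_mk_iff] at hc ⊢
        simpa [Nat.covBy_iff_add_one_eq] using hc
  · rintro ⟨i, j⟩ y hy
    rcases prepend_eq_some.1 hy with ⟨rfl, rfl, rfl⟩ | ⟨k, rfl, hk⟩
    · exact Or.inl (by simp [_root_.prepend])
    · rw [prepend_succ]
      rcases h.target hk with h1 | ⟨⟨i', j'⟩, hc, h1⟩
      · exact Or.inl h1
      · refine Or.inr ⟨(i', j' + 1), ?_, by rwa [prepend_succ]⟩
        rw [Prod.mk_covBy_mk_iff] at hc ⊢
        simpa [Nat.covBy_iff_add_one_eq] using hc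
  · rintro ⟨i, j⟩ ⟨i', j'⟩ v hα hc hv
    rcases j with _ | j
    · obtain rfl := h0.1 hα
      rcases prepend_eq_some.1 hv with ⟨rfl, rfl, -⟩ | ⟨k, rfl, hk⟩
      · exact absurd hc.lt (lt_irrefl _)
      · have := hR _ (h.mem_left hk)
        have := (Prod.mk_le_mk.1 hc.le).1
        simp only at *
        omega
    · rw [hs] at hα
      rw [prepend_succ]
      rcases j' with _ | j'
      · have := (Prod.mk_le_mk.1 hc.le).2
        omega
      · rw [prepend_succ] at hv
        refine h.le hα ?_ hv
        rw [Prod.mk_covBy_mk_iff] at hc ⊢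
        simpa [Nat.covBy_iff_add_one_eq] using hc

lemma IncreasingSkewTableau.prepend {T : ℕ × ℕ → Option ℤ} (h : IncreasingSkewTableau T)
    {R : ℕ} (hR : ∀ p, T p ≠ none → p.1 < R) (x : ℤ) :
    IncreasingSkewTableau (prepend R x T) :=
  ((IsSlideIn.refl h).prepend hR x).skew.1

lemma Set.Finite.exists_fst_lt {S : Set (ℕ × ℕ)} (h : S.Finite) :
    ∃ N, ∀ R, N ≤ R → ∀ p ∈ S, p.1 < R := by
  obtain ⟨⟨a, b⟩, hab⟩ := h.bddAbove
  refine ⟨a + 1, fun R hR p hp => ?_⟩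
  have := (Prod.le_def.1 (hab hp)).1
  simp only at this
  omega

lemma SlideEquiv.prepend {T T' : ℕ × ℕ → Option ℤ} (h : SlideEquiv T T') (x : ℤ) :
    ∃ N, ∀ R, N ≤ R → SlideEquiv (prepend R x T) (prepend R x T') := by
  induction h with
  | rel T T' h =>
    obtain ⟨S, h⟩ := h
    obtain ⟨N, hN⟩ := h.finite.exists_fst_lt
    exact ⟨N, fun R hR => .rel _ _ ⟨_, h.prepend (hN R hR) x⟩⟩
  | refl T => exact ⟨0, fun _ _ => .refl _⟩
  | symm _ _ _ ih =>
    obtain ⟨N, hN⟩ := ih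
    exact ⟨N, fun R hR => .symm _ _ (hN R hR)⟩
  | trans _ _ _ _ _ ih1 ih2 =>
    obtain ⟨N, hN⟩ := ih1
    obtain ⟨N', hN'⟩ := ih2
    exact ⟨max N N', fun R hR => .trans _ _ _ (hN R (by omega)) (hN' R (by omega))⟩

lemma slideEquiv_prepend_row {T : ℕ × ℕ → Option ℤ} (h : IncreasingSkewTableau T) {R R' : ℕ}
    (hR : ∀ p, T p ≠ none → p.1 < R) (hRR' : R ≤ R') (x : ℤ) :
    SlideEquiv (prepend R x T) (prepend R' x T) := by
  induction R', hRR' using Nat.le_induction with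
  | base => exact .refl _
  | succ m hm ih =>
    refine ih.trans _ _ _ ?_
    have hsk := h.prepend (R := m) (fun p hp => (hR p hp).trans_le hm) x
    have := slide_rowShift_single hsk.transpose 0 (fun i j k hi => by omega)
    have h' : SlideEquiv (transpose (prepend m x T))
        (rowShift (Pi.single 0 1) (transpose (prepend m x T))) := .symm _ _ (.rel _ _ this)
    have e : prepend (m + 1) x T =
        transpose (rowShift (Pi.single 0 1) (transpose (prepend m x T))) := ?_
    · rw [e]
      exact SlideEquiv.transpose h'
    funext ⟨i, j⟩
    refine Option.ext fun y => ?_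
    simp only [transpose, Prod.swap_prod_mk, rowShift_eq_some, prepend_eq_some]
    rcases j with _ | j
    · constructor
      · rintro (⟨rfl, -, rfl⟩ | ⟨k, hk, -⟩)
        · exact ⟨m, by simp, Or.inl ⟨rfl, rfl, rfl⟩⟩
        · omega
      · rintro ⟨k, rfl, ⟨rfl, -, rfl⟩ | ⟨k, hk, -⟩⟩
        · exact Or.inl ⟨by simp, rfl, rfl⟩
        · omega
    · simp

/-- `w` is the row word of `T`. -/
def HasWord (T : ℕ × ℕ → Option ℤ) (w : List ℤ) : Prop :=
  ∃ R C, BoundedBy T R C ∧ rowWord T R C = w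

lemma rowWord_succ (T : ℕ × ℕ → Option ℤ) (R C : ℕ) :
    rowWord T (R + 1) C = (List.range (C + 1)).filterMap (fun c => T (R + 1, c)) ++
      rowWord T R C := by
  rw [rowWord, List.range_succ (n := R + 1), List.reverse_append, List.reverse_singleton,
      List.singleton_append, List.flatMap_cons, ← rowWord]

lemma filterMap_range_shift (f : ℕ → Option ℤ) (n d : ℕ) :
    (List.range (d + n)).filterMap (fun j => if d ≤ j then f (j - d) else none) =
      (List.range n).filterMap f := by
  rw [List.range_add, List.filterMap_append, List.filterMap_map,
    List.filterMap_eq_nil_iff.2 (fun j hj => by simp at hj; simp; omega)]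
  simp

lemma BoundedBy.rowWord_rowShift {T : ℕ × ℕ → Option ℤ} {R C C' : ℕ} (h : BoundedBy T R C)
    {f : ℕ → ℕ} (hf : ∀ i ≤ R, C + f i ≤ C') : BoundedBy (rowShift f T) R C' ∧
      rowWord (rowShift f T) R C' = rowWord T R C := by
  constructor
  · rintro ⟨i, j⟩ hp
    obtain ⟨k, rfl, hk⟩ := rowShift_ne_none.1 hp
    have := h _ hk
    have := hf i this.1
    simp only at *
    omega
  · simp only [rowWord, List.flatMap_def]
    congr 1
    refine List.map_congr_left fun i hi => ?_
    have hi : i ≤ R := by simp at hi; omega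
    rw [← filterMap_range_shift _ (C + 1) (f i)]
    have := hf i hi
    refine filterMap_range_eq (by omega) fun j hj => ?_
    by_contra hne
    obtain ⟨k, rfl, hk⟩ := rowShift_ne_none.1 hne
    have := (h _ hk).2
    simp only at this
    omega

lemma HasWord.prepend {T : ℕ × ℕ → Option ℤ} {w : List ℤ} (h : HasWord T w) {R : ℕ}
    (hR : ∀ p, T p ≠ none → p.1 < R) (x : ℤ) : HasWord (prepend R x T) (x :: w) := by
  obtain ⟨R₀, C, hb, rfl⟩ := h
  refine ⟨R + 1, C + 1, ?_, ?_⟩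
  · rintro ⟨i, j⟩ hp
    obtain ⟨y, hy⟩ := Option.ne_none_iff_exists'.1 hp
    rcases prepend_eq_some.1 hy with ⟨rfl, rfl, -⟩ | ⟨k, rfl, hk⟩
    · simp
    · have h1 := hR (i, k) (by simp [hk])
      have h2 := (hb (i, k) (by simp [hk])).2
      simp only at *
      omega
  · have hb' : BoundedBy T R C := fun p hp => ⟨(hR p hp).le, (hb p hp).2⟩
    have hn : ∀ i j, R ≤ i → T (i, j) = none := fun i j hi => by
      by_contra hne
      exact absurd (hR _ hne) (by simpa using hi)
    rw [rowWord_succ, List.filterMap_eq_nil_iff.2]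
    · rcases R with _ | R
      · have h0 : rowWord T R₀ C = [] := by
          simp only [rowWord, List.flatMap_eq_nil_iff, List.filterMap_eq_nil_iff]
          exact fun i _ j _ => hn i j (Nat.zero_le _)
        rw [h0]
        simp only [rowWord, zero_add, List.range_one, List.reverse_singleton, List.flatMap_cons,
          List.flatMap_nil, List.append_nil, List.nil_append]
        rw [List.range_succ_eq_map, List.filterMap_cons, List.filterMap_map,
          List.filterMap_eq_nil_iff.2]
        · simp [_root_.prepend]
        · intro j _
          simp [prepend_succ, hn]
      · rw [List.nil_append, rowWord_succ]
        have hb'' : BoundedBy T R C :=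
          fun p hp => ⟨Nat.lt_succ_iff.1 (hR p hp), (hb p hp).2⟩
        have e : rowWord (_root_.prepend (R + 1) x T) R (C + 1) =
            rowWord (rowShift (fun _ => 1) T) R (C + 1) :=
          rowWord_congr fun i hi j _ => by
            have : i ≠ R + 1 := by omega
            simp [_root_.prepend, this]
        rw [e, (hb''.rowWord_rowShift fun _ _ => le_rfl).2, hb.rowWord_eq hb'',
          List.range_succ_eq_map, List.filterMap_cons, List.filterMap_map,
          List.filterMap_eq_nil_iff.2]
        · simp [_root_.prepend]
        · intro j _
          simp [prepend_succ, hn]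
    · intro j _
      rcases j with _ | j
      · exact prepend_zero (by omega)
      · simp [prepend_succ, hn]

lemma HasWord.transpose_prepend {T : ℕ × ℕ → Option ℤ} {w : List ℤ} (h : HasWord T w) {C : ℕ}
    (hC : ∀ p, T p ≠ none → p.2 < C) (x : ℤ) :
    HasWord (transpose (_root_.prepend C x (transpose T))) (w ++ [x]) := by
  obtain ⟨R, C₀, hb, rfl⟩ := h
  have hb' : BoundedBy T R C := fun p hp => ⟨(hb p hp).1, (hC p hp).le⟩
  rw [hb'.rowWord_eq hb]
  have hrow : ∀ i j, transpose (_root_.prepend C x (transpose T)) (i + 1, j) = T (i, j) :=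
    fun i j => by simp [transpose, prepend_succ]
  refine ⟨R + 1, C, ?_, ?_⟩
  · rintro ⟨i, j⟩ hp
    rcases i with _ | i
    · have : j = C := by
        by_contra hj
        exact hp (prepend_zero hj)
      simp [this]
    · rw [hrow] at hp
      have := hb' _ hp
      simp only at *
      omega
  · have h0 : (List.range (C + 1)).filterMap
        (fun j => transpose (_root_.prepend C x (transpose T)) (0, j)) = [x] := by
      rw [List.range_succ, List.filterMap_append, List.filterMap_eq_nil_iff.2]
      · simp [transpose, _root_.prepend]
      · intro j hj
        simp only [List.mem_range] at hj
        exact prepend_zero hj.ne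
    rw [rowWord, List.range_succ_eq_map (n := R + 1), List.reverse_cons, List.flatMap_append,
      ← List.map_reverse, List.flatMap_map, List.flatMap_cons, List.flatMap_nil,
      List.append_nil, h0]
    simp only [Nat.succ_eq_add_one, hrow]
    rfl

lemma IncreasingSkewTableau.translate_restrict {T U : ℕ × ℕ → Option ℤ}
    (hT : IncreasingSkewTableau T) {r : ℕ}
    (hU : ∀ i j y, U (i, j) = some y ↔ i ≤ r ∧ T (i, j + 1) = some y) :
    IncreasingSkewTableau U := by
  have hU' : ∀ i j, (i, j) ∈ shapeOf U ↔ i ≤ r ∧ (i, j + 1) ∈ shapeOf T := by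
    intro i j
    simp only [mem_shapeOf_iff, hU, exists_and_left]
  refine ⟨hasSkewShape_of_ordConnected ?_ ⟨?_⟩, ?_⟩
  · refine (hT.1.finite.preimage (f := fun p : ℕ × ℕ => (p.1, p.2 + 1)) ?_).subset ?_
    · rintro ⟨i, j⟩ - ⟨i', j'⟩ - h
      simpa using h
    · rintro ⟨i, j⟩ h
      exact ((hU' i j).1 h).2
  · rintro ⟨i, j⟩ h ⟨i', j'⟩ h' ⟨k, l⟩ ⟨⟨h1, h2⟩, ⟨h3, h4⟩⟩
    simp only at h1 h2 h3 h4
    rw [hU'] at h h' ⊢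
    exact ⟨h3.trans h'.1, hT.ordConnected h.2 h'.2 h1 (by omega) h3 (by omega)⟩
  · rintro ⟨i, j⟩ ⟨i', j'⟩ hlt y z hy hz
    rw [hU] at hy hz
    refine hT.2 _ _ ?_ _ _ hy.2 hz.2
    rw [Prod.mk_lt_mk] at hlt ⊢
    omega

/-- Removing the first box in reading order removes the first letter of the row word. -/
lemma rowWord_eq_cons_eraseBox {T : ℕ × ℕ → Option ℤ} {r c C : ℕ} {x : ℤ} (hx : T (r, c) = some x)
    (hc : c ≤ C) (hmin : ∀ j < c, T (r, j) = none) :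
    rowWord T r C = x :: rowWord (eraseBox T r c) r C := by
  obtain ⟨l, hl, hl', -⟩ := List.exists_range_eq_append (show c < C + 1 by omega)
  have h1 : ((List.range r).reverse.flatMap fun i =>
      (List.range (C + 1)).filterMap fun j => eraseBox T r c (i, j)) =
      (List.range r).reverse.flatMap fun i =>
      (List.range (C + 1)).filterMap fun j => T (i, j) := by
    simp only [List.flatMap_def]
    congr 1
    refine List.map_congr_left fun i hi => List.filterMap_congr fun j hj => ?_
    simp only [List.mem_reverse, List.mem_range] at hi
    simp [eraseBox, hi.ne]
  have h2 : l.filterMap (fun j => eraseBox T r c (r, j)) = l.filterMap fun j => T (r, j) :=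
    List.filterMap_congr fun j hj => by simp [eraseBox, (hl' j hj).ne']
  have h3 : (List.range c).filterMap (fun j => eraseBox T r c (r, j)) = [] :=
    List.filterMap_eq_nil_iff.2 fun j hj => by
      simp only [List.mem_range] at hj
      simp [eraseBox, hj.ne, hmin j hj]
  have h4 : (List.range c).filterMap (fun j => T (r, j)) = [] :=
    List.filterMap_eq_nil_iff.2 fun j hj => hmin j (by simpa using hj)
  have h5 : eraseBox T r c (r, c) = none := by simp [eraseBox]
  simp only [rowWord, List.range_succ (n := r), List.reverse_append, List.reverse_singleton,
    List.singleton_append, List.flatMap_cons, h1]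
  simp only [hl, List.filterMap_append, List.filterMap_cons, h2, h3, h4, h5, hx]
  simp

lemma exists_slideEquiv_prepend_of_eq_some {T : ℕ × ℕ → Option ℤ} (hT : IncreasingSkewTableau T)
    {r c C : ℕ} {x : ℤ} (hx : T (r, c) = some x) (hb : BoundedBy T r C)
    (hmin : ∀ j < c, T (r, j) = none) :
    ∃ U, IncreasingSkewTableau U ∧ (∀ p, U p ≠ none → p.1 < r + 1) ∧
      HasWord U (rowWord (eraseBox T r c) r C) ∧ SlideEquiv T (prepend (r + 1) x U) := by
  have hcC : c ≤ C := (hb (r, c) (by simp [hx])).2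
  set E := eraseBox T r c with hE
  have hEs : ∀ {i j y}, E (i, j) = some y ↔ (i, j) ≠ (r, c) ∧ T (i, j) = some y := by
    intro i j y
    simp only [hE, eraseBox]
    split_ifs with h <;> simp [h]
  have hEb : BoundedBy E r C := by
    rintro ⟨i, j⟩ h
    obtain ⟨y, hy⟩ := Option.ne_none_iff_exists'.1 h
    exact hb _ (by simp [(hEs.1 hy).2])
  have hT' : ∀ {i j y}, T (i, j) = some y → i ≤ r ∧ j ≤ C :=
    fun {i j _} h => hb (i, j) (by simp [h])
  obtain ⟨M, hM⟩ : ∃ M, M = C + 2 := ⟨_, rfl⟩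
  have hmul : ∀ a b : ℕ, a < b → a * M + M ≤ b * M := fun a b h => by
    rw [← Nat.succ_mul]
    exact Nat.mul_le_mul_right _ h
  set f : ℕ → ℕ := fun i => (r - i) * M with hf
  set g : ℕ → ℕ := fun i => (r + 1 - i) * M with hg
  have hfr : ∀ i, r ≤ i → f i = 0 := fun i hi => by simp [hf, Nat.sub_eq_zero_of_le hi]
  have hgr : ∀ i, r + 1 ≤ i → g i = 0 := fun i hi => by simp [hg, Nat.sub_eq_zero_of_le hi]
  have hfi : ∀ i i', i < i' → i < r → f i' + M ≤ f i := fun i i' h h' => hmul _ _ (by omega)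
  have hgi : ∀ i i', i < i' → i < r + 1 → g i' + M ≤ g i := fun i i' h h' => hmul _ _ (by omega)
  have hfi' : ∀ i i', i ≤ i' → f i' ≤ f i := fun i i' h => Nat.mul_le_mul_right _ (by omega)
  have hgi' : ∀ i i', i ≤ i' → g i' ≤ g i := fun i i' h => Nat.mul_le_mul_right _ (by omega)
  clear_value f g
  -- spread the rows apart
  have e1 : SlideEquiv T (rowShift f T) := by
    refine slideEquiv_rowShift hT f fun i' i j' j hi h' h h0 => ?_
    obtain ⟨y, hy⟩ := Option.ne_none_iff_exists'.1 h
    have hir : i < r := by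
      by_contra hn
      exact h0 (hfr i (by omega))
    have := hfi i' i hi (by omega)
    have := hT' hy
    omega
  have hT1 : IncreasingSkewTableau (rowShift f T) := e1.skew_iff.1 hT
  -- move the first box down
  set T2 := transpose (rowShift (Pi.single c 1) (transpose (rowShift f T))) with hT2
  have e2 : SlideEquiv (rowShift f T) T2 := by
    refine .symm _ _ (SlideEquiv.transpose (T' := transpose (rowShift f T)) (.rel _ _ ?_))
    refine slide_rowShift_single hT1.transpose c fun i j k hi h h' => ?_
    obtain ⟨l, rfl, hl⟩ := rowShift_ne_none.1 (show rowShift f T (j, i) ≠ none from h)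
    obtain ⟨y, hy⟩ := Option.ne_none_iff_exists'.1 hl
    have h1 := hT' hy
    rcases h1.1.lt_or_eq with h2 | rfl
    · have := hfi j r h2 h2
      omega
    · rw [hmin l (by omega)] at hy
      simp at hy
  have hT2s : ∀ {i j y}, T2 (i, j) = some y ↔
      (i = r + 1 ∧ j = c ∧ x = y) ∨ ∃ k, j = k + f i ∧ E (i, k) = some y := by
    intro i j y
    simp only [hT2, transpose, Prod.swap_prod_mk, rowShift_eq_some, hEs]
    by_cases hj : j = c
    · subst hj
      constructor
      · rintro ⟨k, rfl, l, hl, hy⟩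
        have h1 := hT' hy
        rcases h1.1.lt_or_eq with h2 | rfl
        · have := hfi k r h2 h2
          omega
        · have := hfr k le_rfl
          obtain rfl : j = l := by omega
          rw [hx] at hy
          simp at hy
          simp [hy]
      · rintro (⟨rfl, -, rfl⟩ | ⟨k, hk, hne, hy⟩)
        · exact ⟨r, by simp, j, by simp [hfr r le_rfl], hx⟩
        · exfalso
          have h1 := hT' hy
          rcases h1.1.lt_or_eq with h2 | rfl
          · have := hfi i r h2 h2
            omega
          · rw [hfr i le_rfl] at hk
            exact hne (by rw [hk, Nat.add_zero])
    · simp only [Pi.single_eq_of_ne hj, hj, false_and, and_false, false_or, add_zero]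
      constructor
      · rintro ⟨k, rfl, l, hl, hy⟩
        refine ⟨l, hl, fun h => hj ?_, hy⟩
        obtain ⟨rfl, rfl⟩ := Prod.mk.inj h
        rw [hl, hfr i le_rfl, Nat.add_zero]
      · rintro ⟨k, hk, -, hy⟩
        exact ⟨i, rfl, k, hk, hy⟩
  have hsk2 : IncreasingSkewTableau T2 := e2.skew_iff.1 hT1
  clear_value T2
  -- make room below the remaining rows
  have e3 : SlideEquiv T2 (rowShift g T2) := by
    refine slideEquiv_rowShift hsk2 g fun i' i j' j hi h' h h0 => ?_
    obtain ⟨y', hy'⟩ := Option.ne_none_iff_exists'.1 h'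
    obtain ⟨y, hy⟩ := Option.ne_none_iff_exists'.1 h
    have hir : i < r + 1 := by
      by_contra hn
      exact h0 (hgr i (by omega))
    rcases hT2s.1 hy with ⟨h1, -⟩ | ⟨k, rfl, hk⟩
    · omega
    rcases hT2s.1 hy' with ⟨h1, -⟩ | ⟨k', rfl, hk'⟩
    · omega
    have := hgi i' i hi (by omega)
    have := hfi' i' i hi.le
    have := hT' (hEs.1 hk).2
    omega
  have hsk3 : IncreasingSkewTableau (rowShift g T2) := e3.skew_iff.1 hsk2
  have hT3s : ∀ {i j y}, rowShift g T2 (i, j) = some y ↔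
      (i = r + 1 ∧ j = c ∧ x = y) ∨ ∃ k, j = k + f i + g i ∧ E (i, k) = some y := by
    intro i j y
    simp only [rowShift_eq_some, hT2s]
    constructor
    · rintro ⟨k, rfl, ⟨rfl, rfl, rfl⟩ | ⟨l, rfl, hl⟩⟩
      · exact Or.inl ⟨rfl, by rw [hgr _ le_rfl, Nat.add_zero], rfl⟩
      · exact Or.inr ⟨l, rfl, hl⟩
    · rintro (⟨rfl, rfl, rfl⟩ | ⟨l, rfl, hl⟩)
      · exact ⟨j, by rw [hgr _ le_rfl, Nat.add_zero], Or.inl ⟨rfl, rfl, rfl⟩⟩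
      · exact ⟨l + f i, rfl, Or.inr ⟨l, rfl, hl⟩⟩
  set U := rowShift (fun i => f i + g i - 1) E with hU
  have hUs : ∀ {i j y}, U (i, j) = some y ↔ ∃ k, j + 1 = k + f i + g i ∧ E (i, k) = some y := by
    intro i j y
    simp only [hU, rowShift_eq_some]
    refine exists_congr fun k => and_congr_left fun hk => ?_
    have := hgi i (r + 1) (by have := hT' (hEs.1 hk).2; omega)
      (by have := hT' (hEs.1 hk).2; omega)
    omega
  have hUr : ∀ p, U p ≠ none → p.1 < r + 1 := by
    rintro ⟨i, j⟩ h
    obtain ⟨y, hy⟩ := Option.ne_none_iff_exists'.1 h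
    obtain ⟨k, -, hk⟩ := hUs.1 hy
    exact Nat.lt_succ_iff.2 (hT' (hEs.1 hk).2).1
  have hUsk : IncreasingSkewTableau U := by
    refine hsk3.translate_restrict (r := r) fun i j y => ?_
    rw [hUs, hT3s]
    constructor
    · rintro ⟨k, h1, h2⟩
      exact ⟨(hT' (hEs.1 h2).2).1, Or.inr ⟨k, h1, h2⟩⟩
    · rintro ⟨hi, ⟨rfl, -⟩ | h⟩
      · omega
      · exact h
  have hPsk := hUsk.prepend hUr x
  have e4 : SlideEquiv (prepend (r + 1) x U) (rowShift (Pi.single (r + 1) c)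
      (prepend (r + 1) x U)) := by
    refine slideEquiv_rowShift hPsk _ fun i' i j' j hi h' h h0 => ?_
    have hir : i = r + 1 := by
      by_contra hn
      exact h0 (Pi.single_eq_of_ne hn _)
    obtain ⟨y', hy'⟩ := Option.ne_none_iff_exists'.1 h'
    obtain ⟨y, hy⟩ := Option.ne_none_iff_exists'.1 h
    rcases prepend_eq_some.1 hy with ⟨-, rfl, -⟩ | ⟨k, rfl, hk⟩
    · rcases prepend_eq_some.1 hy' with ⟨rfl, -⟩ | ⟨k, rfl, hk⟩
      · omega
      · obtain ⟨l, hl, -⟩ := hUs.1 hk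
        have := hgi i' (r + 1) (by omega) (by omega)
        subst hir
        rw [Pi.single_eq_same, Pi.single_eq_of_ne hi.ne]
        omega
    · have := hUr (i, k) (by simp [hk])
      simp only at this
      omega
  have e5 : rowShift (Pi.single (r + 1) c) (prepend (r + 1) x U) = rowShift g T2 := by
    funext ⟨i, j⟩
    refine Option.ext fun y => ?_
    rw [hT3s, rowShift_eq_some]
    simp only [prepend_eq_some, hUs]
    constructor
    · rintro ⟨k, rfl, ⟨rfl, rfl, rfl⟩ | ⟨l, rfl, m, hm, hy⟩⟩
      · exact Or.inl ⟨rfl, by simp, rfl⟩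
      · refine Or.inr ⟨m, ?_, hy⟩
        have := (hT' (hEs.1 hy).2).1
        rw [Pi.single_eq_of_ne (by omega)]
        omega
    · rintro (⟨rfl, rfl, rfl⟩ | ⟨m, rfl, hy⟩)
      · exact ⟨0, by simp, Or.inl ⟨rfl, rfl, rfl⟩⟩
      · have := (hT' (hEs.1 hy).2).1
        have := hgi i (r + 1) (by omega) (by omega)
        refine ⟨m + f i + g i, ?_, Or.inr ⟨m + f i + g i - 1, by omega, m, by omega, hy⟩⟩
        rw [Pi.single_eq_of_ne (by omega), Nat.add_zero]
  refine ⟨U, hUsk, hUr, ⟨r, C + f 0 + g 0, ?_⟩, ?_⟩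
  · refine hEb.rowWord_rowShift fun i _ => ?_
    have := hfi' 0 i (Nat.zero_le _)
    have := hgi' 0 i (Nat.zero_le _)
    omega
  · rw [e5] at e4
    exact .trans _ _ _ e1 (.trans _ _ _ e2 (.trans _ _ _ e3 (.symm _ _ e4)))

lemma HasWord.nil_iff {T : ℕ × ℕ → Option ℤ} : HasWord T [] ↔ T = fun _ => none := by
  constructor
  · rintro ⟨R, C, hb, hw⟩
    funext ⟨i, j⟩
    by_contra hne
    have := hb _ hne
    simp only [rowWord, List.flatMap_eq_nil_iff, List.filterMap_eq_nil_iff] at hw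
    simp only at this
    exact hne (hw i (by simp; omega) j (by simp; omega))
  · rintro rfl
    exact ⟨0, 0, fun p hp => absurd rfl hp, by simp [rowWord]⟩

lemma HasWord.unique {T : ℕ × ℕ → Option ℤ} {w w' : List ℤ} (h : HasWord T w)
    (h' : HasWord T w') : w = w' := by
  obtain ⟨R, C, hb, rfl⟩ := h
  obtain ⟨R', C', hb', rfl⟩ := h'
  exact hb'.rowWord_eq hb

lemma exists_slideEquiv_prepend {T : ℕ × ℕ → Option ℤ} (hT : IncreasingSkewTableau T) {x : ℤ}
    {w : List ℤ} (h : HasWord T (x :: w)) :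
    ∃ R U, IncreasingSkewTableau U ∧ (∀ p, U p ≠ none → p.1 < R) ∧ HasWord U w ∧
      SlideEquiv T (prepend R x U) := by
  have hw := h
  obtain ⟨R, C, hb, -⟩ := h
  have hne : ∃ i j, T (i, j) ≠ none := by
    by_contra hn
    push Not at hn
    have : T = fun _ => none := funext fun ⟨i, j⟩ => hn i j
    exact absurd (hw.unique (HasWord.nil_iff.2 this)) (by simp)
  have hP : ∃ r ≤ R, ∃ j, T (r, j) ≠ none := by
    obtain ⟨i, j, h⟩ := hne
    exact ⟨i, (hb _ h).1, j, h⟩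
  obtain ⟨i₀, hi₀, hj₀⟩ := hP
  have hr := Nat.findGreatest_spec (P := fun r => ∃ j, T (r, j) ≠ none) hi₀ hj₀
  set r := Nat.findGreatest (fun r => ∃ j, T (r, j) ≠ none) R with hrdef
  have hmax : ∀ p, T p ≠ none → p.1 ≤ r := fun p hp =>
    Nat.le_findGreatest (hb p hp).1 ⟨p.2, hp⟩
  obtain ⟨y, hy⟩ := Option.ne_none_iff_exists'.1 (Nat.find_spec hr)
  have hmin : ∀ j < Nat.find hr, T (r, j) = none := fun j hj => by
    simpa using Nat.find_min hr hj
  have hb' : BoundedBy T r C := fun p hp => ⟨hmax p hp, (hb p hp).2⟩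
  have hcC : Nat.find hr ≤ C := (hb' (r, Nat.find hr) (by simp [hy])).2
  have e := rowWord_eq_cons_eraseBox hy hcC hmin
  obtain ⟨rfl, rfl⟩ := List.cons.inj (e ▸ hw.unique ⟨r, C, hb', rfl⟩)
  exact ⟨r + 1, exists_slideEquiv_prepend_of_eq_some hT hy hb' hmin⟩

lemma HasWord.slideEquiv {w : List ℤ} : ∀ {T T' : ℕ × ℕ → Option ℤ}, IncreasingSkewTableau T →
    IncreasingSkewTableau T' → HasWord T w → HasWord T' w → SlideEquiv T T' := by
  induction w with
  | nil =>
    intro T T' _ _ h h'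
    rw [HasWord.nil_iff.1 h, HasWord.nil_iff.1 h']
    exact .refl _
  | cons x w ih =>
    intro T T' hT hT' h h'
    obtain ⟨R, U, hU, hR, hw, e⟩ := exists_slideEquiv_prepend hT h
    obtain ⟨R', U', hU', hR', hw', e'⟩ := exists_slideEquiv_prepend hT' h'
    obtain ⟨N, hN⟩ := (ih hU hU' hw hw').prepend x
    exact .trans _ _ _ (.trans _ _ _ e (slideEquiv_prepend_row hU hR
      ((le_max_left R R').trans (le_max_left _ N)) x))
      (.trans _ _ _ (hN _ (le_max_right _ _)) (.symm _ _ (.trans _ _ _ e'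
      (slideEquiv_prepend_row hU' hR' ((le_max_right R R').trans (le_max_left _ N)) x))))

/-- The tableau on the upper left `2 × 2` square with rows `a, b` and `c, d`. -/
def square (a b c d : Option ℤ) : ℕ × ℕ → Option ℤ
  | (0, 0) => a
  | (0, 1) => b
  | (1, 0) => c
  | (1, 1) => d
  | _ => none

lemma square_eq_some {a b c d : Option ℤ} {i j : ℕ} {x : ℤ} :
    square a b c d (i, j) = some x ↔ (i = 0 ∧ j = 0 ∧ a = some x) ∨ (i = 0 ∧ j = 1 ∧ b = some x) ∨
      (i = 1 ∧ j = 0 ∧ c = some x) ∨ (i = 1 ∧ j = 1 ∧ d = some x) := by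
  rcases i with _ | _ | i <;> rcases j with _ | _ | j <;> simp [square]

lemma hasWord_square (a b c d : Option ℤ) :
    HasWord (square a b c d) ([c, d, a, b].filterMap id) := by
  refine ⟨1, 1, ?_, ?_⟩
  · rintro ⟨i, j⟩ h
    obtain ⟨x, hx⟩ := Option.ne_none_iff_exists'.1 h
    rw [square_eq_some] at hx
    simp only
    omega
  · rcases a with _ | a <;> rcases b with _ | b <;> rcases c with _ | c <;> rcases d with _ | d <;>
      simp [rowWord, List.range_succ, square, List.filterMap_cons]

lemma isSlideIn_square {p q s u v w : ℤ} (hps : p < s) (hqs : q < s) (huv : u < v) (huw : u < w)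
    (hp : p = v ∨ p = u) (hq : q = w ∨ q = u) (hs : s = v ∨ s = w) (hu : u = p ∨ u = q)
    (hv : v = p ∨ v = s) (hw : w = q ∨ w = s) :
    IsSlideIn (Set.Iic (1, 1)) (square none (some p) (some q) (some s))
      (square (some u) (some v) (some w) none) where
  finite := Set.finite_Iic _
  ordConnected := Set.ordConnected_Iic
  mem_left := by
    rintro ⟨i, j⟩ x hx
    rw [square_eq_some] at hx
    simp only [Set.mem_Iic, Prod.mk_le_mk]
    omega
  mem_right := by
    rintro ⟨i, j⟩ x hx
    rw [square_eq_some] at hx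
    simp only [Set.mem_Iic, Prod.mk_le_mk]
    omega
  minimal := by
    rintro ⟨i, j⟩ ⟨i', j'⟩ hα hn hβ hlt
    simp only [Set.mem_Iic, Prod.mk_le_mk] at hα hβ
    rw [Prod.mk_lt_mk] at hlt
    obtain ⟨rfl | rfl, rfl | rfl⟩ : (i = 0 ∨ i = 1) ∧ (j = 0 ∨ j = 1) := by omega
    all_goals simp [square] at hn
    omega
  maximal := by
    rintro ⟨i, j⟩ ⟨i', j'⟩ hα hn hβ hlt
    simp only [Set.mem_Iic, Prod.mk_le_mk] at hα hβ
    rw [Prod.mk_lt_mk] at hlt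
    obtain ⟨rfl | rfl, rfl | rfl⟩ : (i = 0 ∨ i = 1) ∧ (j = 0 ∨ j = 1) := by omega
    all_goals simp [square] at hn
    omega
  increasing_left := by
    rintro ⟨i, j⟩ ⟨i', j'⟩ hlt x y hx hy
    rw [square_eq_some] at hx hy
    rw [Prod.mk_lt_mk] at hlt
    simp only [Option.some.injEq, reduceCtorEq, and_false, false_or] at hx hy
    omega
  increasing_right := by
    rintro ⟨i, j⟩ ⟨i', j'⟩ hlt x y hx hy
    rw [square_eq_some] at hx hy
    rw [Prod.mk_lt_mk] at hlt
    simp only [Option.some.injEq, reduceCtorEq, and_false, or_false] at hx hy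
    omega
  source := by
    rintro ⟨i, j⟩ x hx
    simp only [Prod.exists, Prod.mk_covBy_mk_iff, Nat.covBy_iff_add_one_eq, square_eq_some,
      Option.some.injEq, reduceCtorEq, and_false, or_false, false_or] at hx ⊢
    rcases hx with ⟨rfl, rfl, rfl⟩ | ⟨rfl, rfl, rfl⟩ | ⟨rfl, rfl, rfl⟩
    · rcases hp with rfl | rfl
      · simp
      · exact Or.inr ⟨0, 0, by simp⟩
    · rcases hq with rfl | rfl
      · simp
      · exact Or.inr ⟨0, 0, by simp⟩
    · rcases hs with rfl | rfl
      · exact Or.inr ⟨0, 1, by simp⟩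
      · exact Or.inr ⟨1, 0, by simp⟩
  target := by
    rintro ⟨i, j⟩ x hx
    simp only [Prod.exists, Prod.mk_covBy_mk_iff, Nat.covBy_iff_add_one_eq, square_eq_some,
      Option.some.injEq, reduceCtorEq, and_false, or_false, false_or] at hx ⊢
    rcases hx with ⟨rfl, rfl, rfl⟩ | ⟨rfl, rfl, rfl⟩ | ⟨rfl, rfl, rfl⟩
    · rcases hu with rfl | rfl
      · exact Or.inr ⟨0, 1, by simp⟩
      · exact Or.inr ⟨1, 0, by simp⟩
    · rcases hv with rfl | rfl
      · simp
      · exact Or.inr ⟨1, 1, by simp⟩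
    · rcases hw with rfl | rfl
      · simp
      · exact Or.inr ⟨1, 1, by simp⟩
  le := by
    rintro ⟨i, j⟩ ⟨i', j'⟩ y - hc hy
    simp only [Prod.mk_covBy_mk_iff, Nat.covBy_iff_add_one_eq] at hc
    simp only [square_eq_some, Option.some.injEq, reduceCtorEq, and_false, false_or] at hy
    rcases hy with ⟨rfl, rfl, rfl⟩ | ⟨rfl, rfl, rfl⟩ | ⟨rfl, rfl, rfl⟩
    · obtain ⟨rfl, rfl⟩ : i = 0 ∧ j = 0 := by omega
      exact ⟨u, by omega, rfl⟩
    · obtain ⟨rfl, rfl⟩ : i = 0 ∧ j = 0 := by omega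
      exact ⟨u, by omega, rfl⟩
    · obtain ⟨rfl, rfl⟩ | ⟨rfl, rfl⟩ : (i = 0 ∧ j = 1) ∨ (i = 1 ∧ j = 0) := by omega
      · exact ⟨v, by omega, rfl⟩
      · exact ⟨w, by omega, rfl⟩

lemma isSlideIn_corner (a : ℤ) :
    IsSlideIn (Set.Iio (1, 1)) (square none (some a) (some a) none)
      (square (some a) none none none) where
  finite := Set.finite_Iio _
  ordConnected := Set.ordConnected_Iio
  mem_left := by
    rintro ⟨i, j⟩ x hx
    rw [square_eq_some] at hx
    simp only [Set.mem_Iio, Prod.mk_lt_mk]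
    simp only [Option.some.injEq, reduceCtorEq, and_false, false_or, or_false] at hx
    omega
  mem_right := by
    rintro ⟨i, j⟩ x hx
    rw [square_eq_some] at hx
    simp only [Set.mem_Iio, Prod.mk_lt_mk]
    simp only [Option.some.injEq, reduceCtorEq, and_false, or_false] at hx
    omega
  minimal := by
    rintro ⟨i, j⟩ ⟨i', j'⟩ hα hn hβ hlt
    simp only [Set.mem_Iio, Prod.mk_lt_mk] at hα hβ
    rw [Prod.mk_lt_mk] at hlt
    obtain ⟨rfl, rfl⟩ | ⟨rfl, rfl⟩ | ⟨rfl, rfl⟩ :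
      (i = 0 ∧ j = 0) ∨ (i = 0 ∧ j = 1) ∨ (i = 1 ∧ j = 0) := by omega
    all_goals simp [square] at hn
    omega
  maximal := by
    rintro ⟨i, j⟩ ⟨i', j'⟩ hα hn hβ hlt
    simp only [Set.mem_Iio, Prod.mk_lt_mk] at hα hβ
    rw [Prod.mk_lt_mk] at hlt
    obtain ⟨rfl, rfl⟩ | h : (i = 0 ∧ j = 0) ∨ 0 < i + j := by omega
    · simp [square] at hn
    · omega
  increasing_left := by
    rintro ⟨i, j⟩ ⟨i', j'⟩ hlt x y hx hy
    rw [square_eq_some] at hx hy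
    rw [Prod.mk_lt_mk] at hlt
    simp only [Option.some.injEq, reduceCtorEq, and_false, false_or, or_false] at hx hy
    omega
  increasing_right := by
    rintro ⟨i, j⟩ ⟨i', j'⟩ hlt x y hx hy
    rw [square_eq_some] at hx hy
    rw [Prod.mk_lt_mk] at hlt
    simp only [Option.some.injEq, reduceCtorEq, and_false, or_false] at hx hy
    omega
  source := by
    rintro ⟨i, j⟩ x hx
    simp only [Prod.exists, Prod.mk_covBy_mk_iff, Nat.covBy_iff_add_one_eq, square_eq_some,
      Option.some.injEq, reduceCtorEq, and_false, or_false, false_or] at hx ⊢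
    exact Or.inr ⟨0, 0, by omega, by omega⟩
  target := by
    rintro ⟨i, j⟩ x hx
    simp only [Prod.exists, Prod.mk_covBy_mk_iff, Nat.covBy_iff_add_one_eq, square_eq_some,
      Option.some.injEq, reduceCtorEq, and_false, or_false, false_or] at hx ⊢
    exact Or.inr ⟨0, 1, by omega, by omega⟩
  le := by
    rintro ⟨i, j⟩ ⟨i', j'⟩ y - hc hy
    simp only [Prod.mk_covBy_mk_iff, Nat.covBy_iff_add_one_eq] at hc
    simp only [square_eq_some, Option.some.injEq, reduceCtorEq, and_false, false_or,
      or_false] at hy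
    obtain ⟨rfl, rfl⟩ : i = 0 ∧ j = 0 := by omega
    exact ⟨a, by omega, rfl⟩

/-- `w` and `w'` are the row words of two tableaux related by a slide. -/
def SlideLinked (w w' : List ℤ) : Prop :=
  ∃ T T', Slide T T' ∧ HasWord T w ∧ HasWord T' w'

lemma SlideLinked.cons {w w' : List ℤ} (h : SlideLinked w w') (x : ℤ) :
    SlideLinked (x :: w) (x :: w') := by
  obtain ⟨T, T', ⟨S, h⟩, hw, hw'⟩ := h
  obtain ⟨N, hN⟩ := h.finite.exists_fst_lt
  have hN := hN N le_rfl
  refine ⟨_, _, ⟨_, h.prepend hN x⟩, hw.prepend (fun p hp => ?_) x, hw'.prepend (fun p hp => ?_) x⟩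
  · obtain ⟨y, hy⟩ := Option.ne_none_iff_exists'.1 hp
    exact hN _ (h.mem_left hy)
  · obtain ⟨y, hy⟩ := Option.ne_none_iff_exists'.1 hp
    exact hN _ (h.mem_right hy)

lemma SlideLinked.concat {w w' : List ℤ} (h : SlideLinked w w') (x : ℤ) :
    SlideLinked (w ++ [x]) (w' ++ [x]) := by
  obtain ⟨T, T', ⟨S, h⟩, hw, hw'⟩ := h
  obtain ⟨N, hN⟩ := h.transpose.finite.exists_fst_lt
  have hN := hN N le_rfl
  refine ⟨_, _, ⟨_, (h.transpose.prepend hN x).transpose⟩,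
    hw.transpose_prepend (fun p hp => ?_) x, hw'.transpose_prepend (fun p hp => ?_) x⟩
  · obtain ⟨y, hy⟩ := Option.ne_none_iff_exists'.1 hp
    exact hN p.swap (h.mem_left hy)
  · obtain ⟨y, hy⟩ := Option.ne_none_iff_exists'.1 hp
    exact hN p.swap (h.mem_right hy)

lemma SlideLinked.append {w w' : List ℤ} (h : SlideLinked w w') (u v : List ℤ) :
    SlideLinked (u ++ w ++ v) (u ++ w' ++ v) := by
  have h1 : SlideLinked (u ++ w) (u ++ w') := by
    induction u with
    | nil => exact h
    | cons x u ih => exact ih.cons x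
  induction v using List.reverseRecOn with
  | nil => simpa using h1
  | append_singleton v x ih => simpa using ih.concat x

lemma SlideLinked.refl (w : List ℤ) : SlideLinked w w := by
  have h : SlideLinked [] [] := by
    refine ⟨fun _ => none, fun _ => none, ⟨∅, ?_⟩, HasWord.nil_iff.2 rfl, HasWord.nil_iff.2 rfl⟩
    constructor <;> simp [Increasing, Set.ordConnected_empty]
  simpa using h.append w []

lemma KKnuthStep.slideLinked {w w' : List ℤ} (h : KKnuthStep w w') :
    SlideLinked w w' ∨ SlideLinked w' w := by
  cases h with
  | dup u v a =>
    exact Or.inl (SlideLinked.append ⟨_, _, ⟨_, isSlideIn_corner a⟩, hasWord_square ..,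
      hasWord_square ..⟩ u v)
  | aba u v a b =>
    have key : ∀ a b : ℤ, a < b → SlideLinked [a, b, a] [b, a, b] := fun a b h =>
      ⟨_, _, ⟨_, isSlideIn_square (p := a) (q := a) (s := b) (u := a) (v := b) (w := b)
        h h h h (by simp) (by simp) (by simp) (by simp) (by simp) (by simp)⟩,
        hasWord_square .., hasWord_square ..⟩
    rcases lt_trichotomy a b with h | rfl | h
    · exact Or.inl ((key a b h).append u v)
    · exact Or.inl (.refl _)
    · exact Or.inr ((key b a h).append u v)
  | acb u v a b c h1 h2 =>
    exact Or.inr (SlideLinked.append ⟨_, _, ⟨_, isSlideIn_square (p := b) (q := a) (s := c)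
      (u := b) (v := c) (w := a) (by omega) (by omega) (by omega) (by omega) (by simp) (by simp)
      (by simp) (by simp) (by simp) (by simp)⟩, hasWord_square .., hasWord_square ..⟩ u v)
  | bac u v a b c h1 h2 =>
    exact Or.inl (SlideLinked.append ⟨_, _, ⟨_, isSlideIn_square (p := c) (q := a) (s := b)
      (u := a) (v := c) (w := b) (by omega) (by omega) (by omega) (by omega) (by simp) (by simp)
      (by simp) (by simp) (by simp) (by simp)⟩, hasWord_square .., hasWord_square ..⟩ u v)

lemma KKnuth.slideEquiv {w w' : List ℤ} (h : KKnuth w w') : ∀ {T T' : ℕ × ℕ → Option ℤ},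
    IncreasingSkewTableau T → IncreasingSkewTableau T' → HasWord T w → HasWord T' w' →
    SlideEquiv T T' := by
  have key : ∀ {w w'}, SlideLinked w w' → ∀ {T T' : ℕ × ℕ → Option ℤ},
      IncreasingSkewTableau T → IncreasingSkewTableau T' → HasWord T w → HasWord T' w' →
      SlideEquiv T T' := by
    rintro w w' ⟨U, U', ⟨S, h⟩, hU, hU'⟩ T T' hT hT' hw hw'
    exact .trans _ _ _ (hw.slideEquiv hT h.skew.1 hU)
      (.trans _ _ _ (.rel _ _ ⟨S, h⟩) (hU'.slideEquiv h.skew.2 hT' hw'))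
  induction h with
  | rel w w' h =>
    intro T T' hT hT' hw hw'
    rcases h.slideLinked with h | h
    · exact key h hT hT' hw hw'
    · exact .symm _ _ (key h hT' hT hw' hw)
  | refl w =>
    intro T T' hT hT' hw hw'
    exact hw.slideEquiv hT hT' hw'
  | symm _ _ _ ih =>
    intro T T' hT hT' hw hw'
    exact .symm _ _ (ih hT' hT hw' hw)
  | trans w₁ w₂ w₃ _ _ ih1 ih2 =>
    intro T T' hT hT' hw hw'
    obtain ⟨U, U', ⟨S, h⟩, hU, -⟩ := SlideLinked.refl w₂
    exact .trans _ _ _ (ih1 hT h.skew.1 hw hU) (ih2 h.skew.1 hT' hU hw')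

theorem kknuth_iff_jdt_equiv_typeA
    (T T' : ℕ × ℕ → Option ℤ)
    (hT : IncreasingSkewTableau T) (hT' : IncreasingSkewTableau T')
    (rm cm rm' cm' : ℕ) (hb : BoundedBy T rm cm) (hb' : BoundedBy T' rm' cm') :
    KKnuth (rowWord T rm cm) (rowWord T' rm' cm') ↔ JdtEquiv T T' :=
  ⟨fun h => (h.slideEquiv hT hT' ⟨_, _, hb, rfl⟩ ⟨_, _, hb', rfl⟩).jdtEquiv.1,
    fun h => (h.slideEquiv hT).kknuth hT hb hb'⟩
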